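/- Let ζ ∈ 𝕋 and let n ≥ 1 be an integer. If c_μ({ζ}) > 0, then [(z − ζ)ⁿ]_{D(μ)} = M_μ({ζ}) = {g ∈ D(μ) : the radial limit of g at ζ exists and equals 0}. -/

import Mathlib

open MeasureTheory Metric Filter Complex Set
open scoped ENNReal Topology

noncomputable section

namespace DirichletMu

/-- The open unit disc in `ℂ`. -/
def disc : Set ℂ := Metric.ball 0 1

/-- The unit circle `𝕋`. -/
def circleT : Set ℂ := Metric.sphere 0 1

/-- The boundary point `e^{it}`. -/
def bpt (t : ℝ) : ℂ := Complex.exp (Complex.I * (t : ℂ))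

/-- Arc-length parametrizing measure on `(0, 2π]`. -/
def θm : Measure ℝ := volume.restrict (Set.Ioc 0 (2 * Real.pi))

/-- A measure is carried by the unit circle. -/
def OnCircle (μ : Measure ℂ) : Prop := μ circleTᶜ = 0

/-- The mean-square integrals of `f` over circles of radius `r < 1`. -/
def hardySet (f : ℂ → ℂ) : Set ℝ :=
  {x | ∃ r : ℝ, 0 < r ∧ r < 1 ∧
    x = (1 / (2 * Real.pi)) * ∫ t in (0:ℝ)..(2 * Real.pi), ‖f ((r : ℂ) * bpt t)‖ ^ 2}

/-- Membership in the Hardy space `H²`. -/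
def MemHardy2 (f : ℂ → ℂ) : Prop :=
  DifferentiableOn ℂ f disc ∧ BddAbove (hardySet f)

/-- The squared Hardy norm. -/
def hardyNormSq (f : ℂ → ℂ) : ℝ := sSup (hardySet f)

/-- Membership in `H^∞`. -/
def MemHinf (f : ℂ → ℂ) : Prop :=
  DifferentiableOn ℂ f disc ∧ ∃ C : ℝ, ∀ z ∈ disc, ‖f z‖ ≤ C

/-- The sup norm over the disc. -/
def supNorm (f : ℂ → ℂ) : ℝ := sSup ((fun z => ‖f z‖) '' disc)

/-- The Poisson integral of the measure `μ`. -/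
def poissonMu (μ : Measure ℂ) (z : ℂ) : ℝ :=
  ∫ ζ, (1 - ‖z‖ ^ 2) / ‖1 - (starRingEnd ℂ) ζ * z‖ ^ 2 ∂μ

/-- The integrand of the Dirichlet integral. -/
def dirichletDensity (μ : Measure ℂ) (f : ℂ → ℂ) (z : ℂ) : ℝ :=
  ‖deriv f z‖ ^ 2 * poissonMu μ z

/-- The Dirichlet integral `D_μ(f)`. -/
def dirichletIntegral (μ : Measure ℂ) (f : ℂ → ℂ) : ℝ :=
  (1 / Real.pi) * ∫ z in disc, dirichletDensity μ f z

/-- Membership in the Dirichlet-type space `D(μ)`. -/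
def MemD (μ : Measure ℂ) (f : ℂ → ℂ) : Prop :=
  MemHardy2 f ∧ IntegrableOn (dirichletDensity μ f) disc

/-- The squared norm `‖f‖_μ²` of `D(μ)`. -/
def dNormSq (μ : Measure ℂ) (f : ℂ → ℂ) : ℝ :=
  hardyNormSq f + dirichletIntegral μ f

/-- `f` has radial limit `L` at `ζ`. -/
def HasRadialLimitAt (f : ℂ → ℂ) (ζ L : ℂ) : Prop :=
  Tendsto (fun r : ℝ => f ((r : ℂ) * ζ)) (nhdsWithin 1 (Set.Iio 1)) (nhds L)

/-- The modulus of `f` has radial limit `m` at `e^{it}`. -/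
def BoundaryAbs (f : ℂ → ℂ) (t : ℝ) (m : ℝ) : Prop :=
  Tendsto (fun r : ℝ => ‖f ((r : ℂ) * bpt t)‖) (nhdsWithin 1 (Set.Iio 1)) (nhds m)

/-- The boundary zero set `Z_𝕋(f)`. -/
def ZT (f : ℂ → ℂ) : Set ℂ :=
  {ζ | ζ ∈ circleT ∧ HasRadialLimitAt f ζ 0}

/-- The set `Z̲(f)`. -/
def Zlow (f : ℂ → ℂ) : Set ℂ :=
  {ζ | ζ ∈ Metric.closedBall (0 : ℂ) 1 ∧
    Filter.liminf (fun z => ‖f z‖) (nhdsWithin ζ disc) = 0}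

def ZlowSet (S : Set (ℂ → ℂ)) : Set ℂ := ⋂ f ∈ S, Zlow f

def ZTSet (S : Set (ℂ → ℂ)) : Set ℂ := ⋂ f ∈ S, ZT f

/-- `[f]_{D(μ)}`: the closure in `D(μ)` of the polynomial multiples of `f`. -/
def closedSpan (μ : Measure ℂ) (f : ℂ → ℂ) : Set (ℂ → ℂ) :=
  {g | MemD μ g ∧ ∀ ε > 0, ∃ q : Polynomial ℂ,
    dNormSq μ (fun z => g z - q.eval z * f z) < ε}

/-- `f` is cyclic for `D(μ)`. -/
def IsCyclic (μ : Measure ℂ) (f : ℂ → ℂ) : Prop :=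
  closedSpan μ f = {g | MemD μ g}

/-- `f` is the outer function with boundary modulus `φ` (parametrized by `e^{it}`). -/
def OuterWith (f : ℂ → ℂ) (φ : ℝ → ℝ) : Prop :=
  (∀ t, 0 ≤ φ t) ∧
  IntervalIntegrable (fun t => Real.log (φ t)) volume 0 (2 * Real.pi) ∧
  ∀ z ∈ disc, f z = Complex.exp (((2 * Real.pi : ℝ) : ℂ)⁻¹ *
    ∫ t in (0:ℝ)..(2 * Real.pi), ((bpt t + z) / (bpt t - z)) * (Real.log (φ t) : ℂ))

/-- `f` is an outer function. -/
def IsOuter (f : ℂ → ℂ) : Prop := ∃ φ, OuterWith f φ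

/-- Inner functions. -/
def IsInner (f : ℂ → ℂ) : Prop :=
  DifferentiableOn ℂ f disc ∧ (∀ z ∈ disc, ‖f z‖ ≤ 1) ∧
  ∀ᵐ t ∂θm, BoundaryAbs f t 1

/-- `f / Θ ∈ H²`. -/
def InnerDivides (Θ f : ℂ → ℂ) : Prop :=
  ∃ g, MemHardy2 g ∧ ∀ z ∈ disc, f z = Θ z * g z

/-- `Θ / Θ'` is bounded on the disc. -/
def DividesBdd (Θ' Θ : ℂ → ℂ) : Prop :=
  ∃ g, MemHinf g ∧ ∀ z ∈ disc, Θ z = Θ' z * g z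

/-- `Θ` is the greatest common inner divisor of the family `M`. -/
def IsGCDInner (M : Set (ℂ → ℂ)) (Θ : ℂ → ℂ) : Prop :=
  IsInner Θ ∧ (∀ f ∈ M, InnerDivides Θ f) ∧
  ∀ Θ', IsInner Θ' → (∀ f ∈ M, InnerDivides Θ' f) → DividesBdd Θ' Θ

/-- The set `Θ H²`. -/
def innerMulH2 (Θ : ℂ → ℂ) : Set (ℂ → ℂ) :=
  {h | ∃ g, MemHardy2 g ∧ ∀ z ∈ disc, h z = Θ z * g z}

/-- Poisson extension of a boundary function (parametrized by `e^{it}`). -/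
def poissonExt (u : ℝ → ℝ) (z : ℂ) : ℝ :=
  (1 / (2 * Real.pi)) * ∫ t in (0:ℝ)..(2 * Real.pi),
    ((1 - ‖z‖ ^ 2) / ‖bpt t - z‖ ^ 2) * u t

/-- `|∇ P[u]|² P_μ`. -/
def gradDensity (μ : Measure ℂ) (u : ℝ → ℝ) (z : ℂ) : ℝ :=
  ‖fderiv ℝ (poissonExt u) z‖ ^ 2 * poissonMu μ z

/-- Membership in the harmonic Dirichlet space `D^h(μ)`. -/
def MemDh (μ : Measure ℂ) (u : ℝ → ℝ) : Prop :=
  IntegrableOn (fun t => (u t) ^ 2) (Set.Ioc 0 (2 * Real.pi)) volume ∧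
  IntegrableOn (gradDensity μ u) disc

/-- The squared norm of `D^h(μ)`. -/
def dhNormSq (μ : Measure ℂ) (u : ℝ → ℝ) : ℝ :=
  (1 / (2 * Real.pi)) * (∫ t in Set.Ioc 0 (2 * Real.pi), (u t) ^ 2) +
  (1 / Real.pi) * ∫ z in disc, gradDensity μ u z

/-- Relatively open subsets of the circle. -/
def RelOpen (U : Set ℂ) : Prop := ∃ V : Set ℂ, IsOpen V ∧ U = V ∩ circleT

/-- Capacity of a relatively open subset of the circle. -/
def capOpen (μ : Measure ℂ) (U : Set ℂ) : ℝ≥0∞ :=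
  ⨅ (u : ℝ → ℝ) (_ : MemDh μ u ∧ (∀ t, 0 ≤ u t) ∧
      ∀ᵐ t ∂θm, bpt t ∈ U → 1 ≤ u t),
    ENNReal.ofReal (dhNormSq μ u)

/-- The capacity `c_μ` of an arbitrary subset of the circle. -/
def cap (μ : Measure ℂ) (F : Set ℂ) : ℝ≥0∞ :=
  ⨅ (U : Set ℂ) (_ : RelOpen U ∧ F ⊆ U), capOpen μ U

/-- The (closed) support of a measure on `ℂ`. -/
def msupport (μ : Measure ℂ) : Set ℂ :=
  {x | ∀ r > 0, 0 < μ (Metric.ball x r)}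

/-- `M_μ(E)`: functions of `D(μ)` whose radial limits vanish `c_μ`-q.e. on `E`. -/
def Mspace (μ : Measure ℂ) (E : Set ℂ) : Set (ℂ → ℂ) :=
  {g | MemD μ g ∧ ∃ N : Set ℂ, cap μ N = 0 ∧ ∀ ζ ∈ E \ N, HasRadialLimitAt g ζ 0}

/-- Closed shift-invariant subspaces of `D(μ)` (closedness for the `D(μ)` norm). -/
structure ClosedInvSubspace (μ : Measure ℂ) (M : Set (ℂ → ℂ)) : Prop where
  subset : M ⊆ {f | MemD μ f}
  zero_mem : (fun _ => (0 : ℂ)) ∈ M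
  add_mem : ∀ f ∈ M, ∀ g ∈ M, (fun z => f z + g z) ∈ M
  smul_mem : ∀ (c : ℂ), ∀ f ∈ M, (fun z => c * f z) ∈ M
  shift_mem : ∀ f ∈ M, (fun z => z * f z) ∈ M
  closed : ∀ g, MemD μ g →
    (∀ ε > 0, ∃ h ∈ M, dNormSq μ (fun z => g z - h z) < ε) → g ∈ M

/-- The norm `‖f‖_{∞,μ}` of the Banach algebra `D(μ) ∩ H^∞`. -/
def algNorm (μ : Measure ℂ) (f : ℂ → ℂ) : ℝ :=
  supNorm f + Real.sqrt (dirichletIntegral μ f)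

/-- Membership in the Banach algebra `D(μ) ∩ H^∞`. -/
def MemA (μ : Measure ℂ) (f : ℂ → ℂ) : Prop := MemD μ f ∧ MemHinf f

/-- Closed ideals of `D(μ) ∩ H^∞`. -/
structure ClosedIdeal (μ : Measure ℂ) (J : Set (ℂ → ℂ)) : Prop where
  subset : J ⊆ {f | MemA μ f}
  zero_mem : (fun _ => (0 : ℂ)) ∈ J
  add_mem : ∀ f ∈ J, ∀ g ∈ J, (fun z => f z + g z) ∈ J
  mul_mem : ∀ f, MemA μ f → ∀ g ∈ J, (fun z => f z * g z) ∈ J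
  closed : ∀ g, MemA μ g →
    (∀ ε > 0, ∃ h ∈ J, algNorm μ (fun z => g z - h z) < ε) → g ∈ J

/-- A multiplier of `D(μ)`. -/
def IsMultiplier (μ : Measure ℂ) (φ : ℂ → ℂ) : Prop :=
  DifferentiableOn ℂ φ disc ∧ ∀ g, MemD μ g → MemD μ (fun z => φ z * g z)

/-- Distance between two subsets of `ℂ`. -/
def setDist (A B : Set ℂ) : ℝ :=
  sInf ((fun p : ℂ × ℂ => dist p.1 p.2) '' (A ×ˢ B))

lemma norm_bpt (t : ℝ) : ‖bpt t‖ = 1 := by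
  rw [bpt, mul_comm]; exact Complex.norm_exp_ofReal_mul_I t

lemma continuous_bpt : Continuous bpt := by
  unfold bpt; fun_prop

lemma circleMap_eq_bpt (R t : ℝ) : circleMap 0 R t = R * bpt t := by
  simp [circleMap, bpt, mul_comm]

/-- The normalized arc-length measure. -/
def cm : Measure ℝ := ENNReal.ofReal (1 / (2 * Real.pi)) • θm

instance : IsProbabilityMeasure cm := by
  constructor
  have : (0:ℝ) < 2 * Real.pi := by positivity
  simp only [cm, θm, Measure.smul_apply, Measure.restrict_apply_univ, Real.volume_Ioc, smul_eq_mul,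
    sub_zero]
  rw [← ENNReal.ofReal_mul (by positivity), one_div, inv_mul_cancel₀ this.ne', ENNReal.ofReal_one]

lemma integral_cm {E : Type*} [NormedAddCommGroup E] [NormedSpace ℝ E] (f : ℝ → E) :
    ∫ t, f t ∂cm = (1 / (2 * Real.pi)) • ∫ t in (0:ℝ)..(2 * Real.pi), f t := by
  rw [cm, integral_smul_measure, θm, ENNReal.toReal_ofReal (by positivity),
    intervalIntegral.integral_of_le (by positivity)]

lemma integrable_cm {E : Type*} [NormedAddCommGroup E] {f : ℝ → E}
    (hf : Continuous f) : Integrable f cm := by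
  refine Integrable.smul_measure ?_ ENNReal.ofReal_ne_top
  exact (hf.integrableOn_Icc (a := 0) (b := 2 * Real.pi)).mono_set Ioc_subset_Icc_self

/-- The Poisson kernel of the disc. -/
def pk (w e : ℂ) : ℝ := (1 - ‖w‖ ^ 2) / ‖e - w‖ ^ 2

lemma pk_nonneg {w : ℂ} (hw : ‖w‖ < 1) (e : ℂ) : 0 ≤ pk w e := by
  have : ‖w‖ ^ 2 ≤ 1 := pow_le_one₀ (norm_nonneg _) hw.le
  exact div_nonneg (by linarith) (by positivity)

lemma sub_ne_zero_of_norm {w e : ℂ} (hw : ‖w‖ < 1) (he : ‖e‖ = 1) : e - w ≠ 0 := by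
  intro h
  rw [sub_eq_zero] at h
  rw [← h, he] at hw
  exact lt_irrefl _ hw

lemma continuous_pk {w : ℂ} (hw : ‖w‖ < 1) : Continuous fun t => pk w (bpt t) := by
  unfold pk
  refine Continuous.div (by fun_prop) ((continuous_bpt.sub continuous_const).norm.pow 2) ?_
  intro t
  have := sub_ne_zero_of_norm hw (norm_bpt t)
  positivity

lemma poisson_formula {G : ℂ → ℂ} (hG : DiffContOnCl ℂ G (ball 0 1)) {w : ℂ} (hw : ‖w‖ < 1) :
    ∫ t, (pk w (bpt t) : ℂ) * G (bpt t) ∂cm = G w := by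
  have h := hG.circleAverage_poissonKernel_smul' (w := w) (by simpa using hw)
  rw [← h, integral_cm, Real.circleAverage_def]
  simp only [circleMap_eq_bpt, one_div]
  simp [norm_bpt, pk]

lemma integral_pk {w : ℂ} (hw : ‖w‖ < 1) : ∫ t, pk w (bpt t) ∂cm = 1 := by
  have h := poisson_formula (G := fun _ => 1) diffContOnCl_const hw
  simp only [mul_one] at h
  rw [integral_complex_ofReal] at h
  exact_mod_cast h

lemma continuous_comp_bpt {G : ℂ → ℂ} (hG : DiffContOnCl ℂ G (ball 0 1)) :
    Continuous fun t => G (bpt t) := by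
  have h := hG.continuousOn_ball
  exact h.comp_continuous continuous_bpt fun t => by simp [norm_bpt]

lemma poisson_formula_re {G : ℂ → ℂ} (hG : DiffContOnCl ℂ G (ball 0 1)) {w : ℂ} (hw : ‖w‖ < 1) :
    ∫ t, pk w (bpt t) * (G (bpt t)).re ∂cm = (G w).re := by
  have hc := continuous_comp_bpt hG
  have hp := continuous_pk hw
  rw [← poisson_formula hG hw, ← RCLike.re_eq_complex_re, ← integral_re]
  · simp
  · exact integrable_cm ((continuous_ofReal.comp hp).mul hc)

lemma norm_sq_le_poisson {G : ℂ → ℂ} (hG : DiffContOnCl ℂ G (ball 0 1)) {w : ℂ} (hw : ‖w‖ < 1) :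
    ‖G w‖ ^ 2 ≤ ∫ t, pk w (bpt t) * ‖G (bpt t)‖ ^ 2 ∂cm := by
  have hc := continuous_comp_bpt hG
  have hp := continuous_pk hw
  have h0 : 0 ≤ ∫ t, pk w (bpt t) * ‖G (bpt t) - G w‖ ^ 2 ∂cm :=
    integral_nonneg fun t => mul_nonneg (pk_nonneg hw _) (by positivity)
  have h1 : ∀ t, pk w (bpt t) * ‖G (bpt t) - G w‖ ^ 2 =
      pk w (bpt t) * ‖G (bpt t)‖ ^ 2 - 2 * (pk w (bpt t) * (G (bpt t) * starRingEnd ℂ (G w)).re)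
        + pk w (bpt t) * ‖G w‖ ^ 2 := by
    intro t
    simp only [← Complex.normSq_eq_norm_sq, Complex.normSq_sub]
    ring
  have h2 := poisson_formula_re (G := fun z => G z * starRingEnd ℂ (G w))
    (hG.smul_const (starRingEnd ℂ (G w))) hw
  have h3 : (G w * starRingEnd ℂ (G w)).re = ‖G w‖ ^ 2 := by
    rw [Complex.mul_conj, Complex.ofReal_re, Complex.normSq_eq_norm_sq]
  have c1 := hp.mul (hc.norm.pow 2)
  have c2 := (hp.mul (continuous_re.comp
    (hc.mul (continuous_const (y := starRingEnd ℂ (G w)))))).const_mul 2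
  have c3 := hp.mul (continuous_const (y := ‖G w‖ ^ 2))
  simp only [h1] at h0
  rw [integral_add, integral_sub, integral_const_mul, h2, integral_mul_const, integral_pk hw, h3]
    at h0
  · linarith
  · exact integrable_cm c1
  · exact integrable_cm c2
  · exact integrable_cm (c1.sub c2)
  · exact integrable_cm c3

lemma mem_disc {z : ℂ} : z ∈ disc ↔ ‖z‖ < 1 := by simp [disc]

lemma measurableSet_disc : MeasurableSet disc := measurableSet_ball

lemma isOpen_disc : IsOpen disc := isOpen_ball

lemma ae_norm_eq_one {μ : Measure ℂ} (hμ : OnCircle μ) : ∀ᵐ l ∂μ, ‖l‖ = 1 := by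
  have : ∀ᵐ l ∂μ, l ∈ circleT := hμ
  filter_upwards [this] with l hl
  simpa [circleT] using hl

/-- The integrand of `poissonMu`. -/
def bdryKernel (l z : ℂ) : ℝ := (1 - ‖z‖ ^ 2) / ‖1 - (starRingEnd ℂ) l * z‖ ^ 2

lemma bdryKernel_nonneg {z : ℂ} (hz : ‖z‖ < 1) (l : ℂ) : 0 ≤ bdryKernel l z := by
  have : ‖z‖ ^ 2 ≤ 1 := pow_le_one₀ (norm_nonneg _) hz.le
  exact div_nonneg (by linarith) (by positivity)

lemma measurable_bdryKernel : Measurable (Function.uncurry bdryKernel) := by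
  unfold bdryKernel Function.uncurry
  fun_prop

lemma norm_one_sub_conj_mul {l : ℂ} (hl : ‖l‖ = 1) (z : ℂ) :
    ‖1 - (starRingEnd ℂ) l * z‖ = ‖l - z‖ := by
  have h : l - z = l * (1 - (starRingEnd ℂ) l * z) := by
    rw [mul_sub, ← mul_assoc, Complex.mul_conj, Complex.normSq_eq_norm_sq, hl]
    simp
  rw [h, norm_mul, hl, one_mul]

lemma bdryKernel_eq_pk {l : ℂ} (hl : ‖l‖ = 1) (z : ℂ) : bdryKernel l z = pk z l := by
  rw [bdryKernel, norm_one_sub_conj_mul hl, pk]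

/-- The extended-real-valued Poisson integral of `μ`. -/
def poissonLInt (μ : Measure ℂ) (z : ℂ) : ℝ≥0∞ := ∫⁻ l, ENNReal.ofReal (bdryKernel l z) ∂μ

lemma measurable_poissonLInt (μ : Measure ℂ) [IsFiniteMeasure μ] : Measurable (poissonLInt μ) := by
  unfold poissonLInt
  exact Measurable.lintegral_prod_left' (f := fun p : ℂ × ℂ => ENNReal.ofReal (bdryKernel p.1 p.2))
    measurable_bdryKernel.ennreal_ofReal

lemma stronglyMeasurable_poissonMu (μ : Measure ℂ) [IsFiniteMeasure μ] :
    StronglyMeasurable (poissonMu μ) :=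
  StronglyMeasurable.integral_prod_left' (f := Function.uncurry bdryKernel)
    measurable_bdryKernel.stronglyMeasurable

lemma poissonMu_nonneg (μ : Measure ℂ) {z : ℂ} (hz : ‖z‖ < 1) : 0 ≤ poissonMu μ z :=
  integral_nonneg fun l => bdryKernel_nonneg hz l

lemma ofReal_poissonMu {μ : Measure ℂ} [IsFiniteMeasure μ] (hμ : OnCircle μ) {z : ℂ}
    (hz : ‖z‖ < 1) : ENNReal.ofReal (poissonMu μ z) = poissonLInt μ z := by
  have hi : Integrable (fun l => bdryKernel l z) μ := by
    refine Integrable.of_bound (C := 1 / (1 - ‖z‖) ^ 2) ?_ ?_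
    · have : Measurable fun l : ℂ => bdryKernel l z := by
        unfold bdryKernel
        fun_prop
      exact this.aestronglyMeasurable
    · filter_upwards [ae_norm_eq_one hμ] with l hl
      rw [Real.norm_of_nonneg (bdryKernel_nonneg hz l), bdryKernel_eq_pk hl, pk]
      have h1 : 1 - ‖z‖ ≤ ‖l - z‖ := by
        have := norm_sub_norm_le l z
        rwa [hl] at this
      have h2 : 0 < 1 - ‖z‖ := by linarith
      gcongr
      nlinarith [norm_nonneg z]
  unfold poissonLInt
  rw [← ofReal_integral_eq_lintegral_ofReal hi (ae_of_all _ fun l => bdryKernel_nonneg hz l)]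
  rfl

/-- The (unnormalized) Dirichlet integral with values in `[0, ∞]`. -/
def dirichletLInt (μ : Measure ℂ) (f : ℂ → ℂ) : ℝ≥0∞ :=
  ∫⁻ z in disc, ENNReal.ofReal (‖deriv f z‖ ^ 2) * poissonLInt μ z

lemma stronglyMeasurable_dirichletDensity (μ : Measure ℂ) [IsFiniteMeasure μ] (f : ℂ → ℂ) :
    StronglyMeasurable (dirichletDensity μ f) :=
  ((measurable_deriv f).norm.pow_const 2).stronglyMeasurable.mul (stronglyMeasurable_poissonMu μ)

lemma dirichletDensity_nonneg (μ : Measure ℂ) (f : ℂ → ℂ) {z : ℂ} (hz : ‖z‖ < 1) :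
    0 ≤ dirichletDensity μ f z :=
  mul_nonneg (by positivity) (poissonMu_nonneg μ hz)

lemma lintegral_dirichletDensity {μ : Measure ℂ} [IsFiniteMeasure μ] (hμ : OnCircle μ) (f : ℂ → ℂ) :
    ∫⁻ z in disc, ENNReal.ofReal (dirichletDensity μ f z) = dirichletLInt μ f := by
  refine setLIntegral_congr_fun measurableSet_disc fun z hz => ?_
  rw [dirichletDensity, ENNReal.ofReal_mul (by positivity), ofReal_poissonMu hμ (mem_disc.1 hz)]

lemma ae_dirichletDensity_nonneg (μ : Measure ℂ) [IsFiniteMeasure μ] (f : ℂ → ℂ) :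
    0 ≤ᵐ[volume.restrict disc] dirichletDensity μ f := by
  filter_upwards [ae_restrict_mem measurableSet_disc] with z hz
  exact dirichletDensity_nonneg μ f (mem_disc.1 hz)

lemma integrableOn_dirichletDensity_iff {μ : Measure ℂ} [IsFiniteMeasure μ] (hμ : OnCircle μ) (f : ℂ → ℂ) :
    IntegrableOn (dirichletDensity μ f) disc ↔ dirichletLInt μ f ≠ ⊤ := by
  rw [← lintegral_dirichletDensity hμ, IntegrableOn, ← lt_top_iff_ne_top,
    ← hasFiniteIntegral_iff_ofReal (ae_dirichletDensity_nonneg μ f)]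
  exact ⟨fun h => h.2, fun h => ⟨(stronglyMeasurable_dirichletDensity μ f).aestronglyMeasurable, h⟩⟩

lemma dirichletIntegral_eq {μ : Measure ℂ} [IsFiniteMeasure μ] (hμ : OnCircle μ) (f : ℂ → ℂ) :
    dirichletIntegral μ f = (1 / Real.pi) * (dirichletLInt μ f).toReal := by
  rw [dirichletIntegral, ← lintegral_dirichletDensity hμ,
    integral_eq_lintegral_of_nonneg_ae (ae_dirichletDensity_nonneg μ f)
      (stronglyMeasurable_dirichletDensity μ f).aestronglyMeasurable]

lemma lintegral_disc_rotate (t : ℝ) (h : ℂ → ℝ≥0∞) :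
    ∫⁻ z in disc, h (bpt t * z) = ∫⁻ z in disc, h z := by
  let a : Circle := ⟨bpt t, by simp [Submonoid.unitSphere, norm_bpt]⟩
  have h1 := ((rotation a).measurePreserving).setLIntegral_comp_emb
    (rotation a).toHomeomorph.measurableEmbedding h disc
  have h0 : ∀ z, rotation a z = bpt t * z := fun z => rotation_apply a z
  simp only [h0] at h1
  have h2 : (fun z => bpt t * z) '' disc = disc := by
    have h3 := (rotation a).image_ball 0 1
    rw [map_zero] at h3
    exact (image_congr fun z _ => (h0 z).symm).trans h3
  rw [h2] at h1
  exact h1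

lemma lintegral_disc_rotation_average {h : ℂ → ℝ≥0∞} (hh : Measurable h) :
    ∫⁻ z in disc, ∫⁻ t, h (bpt t * z) ∂cm = ∫⁻ z in disc, h z := by
  rw [lintegral_lintegral_swap]
  · simp [lintegral_disc_rotate]
  · have := continuous_bpt.measurable
    exact (hh.comp (by fun_prop : Measurable fun p : ℂ × ℝ => bpt p.2 * p.1)).aemeasurable

lemma lintegral_disc_dilate {s : ℝ} (hs : 0 < s) (hs1 : s ≤ 1) (h : ℂ → ℝ≥0∞) :
    ENNReal.ofReal (s ^ 2) * ∫⁻ z in disc, h (s * z) ≤ ∫⁻ z in disc, h z := by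
  have hm : MeasurableEmbedding fun z : ℂ => s • z :=
    (Homeomorph.smulOfNeZero s hs.ne').measurableEmbedding
  have h1 : Measure.map (fun z : ℂ => s • z) volume =
      ENNReal.ofReal (|(s ^ 2)⁻¹|) • (volume : Measure ℂ) := by
    simpa using Measure.map_addHaar_smul (volume : Measure ℂ) hs.ne'
  have h2 : ∫⁻ z in disc, h (s * z) ≤ ∫⁻ z in (fun z : ℂ => s • z) ⁻¹' disc, h (s • z) := by
    simp only [Complex.real_smul]
    refine lintegral_mono_set fun z hz => ?_
    rw [mem_disc] at hz
    simp only [mem_preimage, mem_disc, norm_mul, Complex.norm_real, Real.norm_of_nonneg hs.le]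
    nlinarith [norm_nonneg z]
  have h3 : ∫⁻ z in (fun z : ℂ => s • z) ⁻¹' disc, h (s • z) =
      ENNReal.ofReal (|(s ^ 2)⁻¹|) * ∫⁻ z in disc, h z := by
    rw [← hm.lintegral_map (f := h), ← hm.restrict_map, h1, Measure.restrict_smul,
      lintegral_smul_measure, smul_eq_mul]
  rw [h3] at h2
  calc _ ≤ ENNReal.ofReal (s ^ 2) * (ENNReal.ofReal (|(s ^ 2)⁻¹|) * ∫⁻ z in disc, h z) := by gcongr
    _ = _ := by
      rw [← mul_assoc, ← ENNReal.ofReal_mul (by positivity), abs_of_pos (by positivity),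
        mul_inv_cancel₀ (by positivity), ENNReal.ofReal_one, one_mul]

lemma bpt_neg (t : ℝ) : bpt (-t) = (starRingEnd ℂ) (bpt t) := by
  rw [bpt, bpt, ← Complex.exp_conj]
  simp

lemma pk_eq_re {l z : ℂ} (hl : ‖l‖ = 1) (hz : ‖z‖ < 1) : pk z l = ((l + z) / (l - z)).re := by
  have h := sub_ne_zero_of_norm hz hl
  have h1 : (l + z) * (starRingEnd ℂ) (l - z) = (l + z) / (l - z) * (‖l - z‖ ^ 2 : ℝ) := by
    rw [← Complex.normSq_eq_norm_sq, ← Complex.mul_conj]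
    field_simp
  have h2 : ((l + z) * (starRingEnd ℂ) (l - z)).re = 1 - ‖z‖ ^ 2 := by
    have h3 : l.re ^ 2 + l.im ^ 2 = 1 := by
      have := Complex.sq_norm l
      rw [hl, Complex.normSq_apply] at this
      linarith
    rw [Complex.sq_norm, Complex.normSq_apply]
    simp
    linarith
  rw [h1, Complex.re_mul_ofReal] at h2
  have h3 : 0 < ‖l - z‖ := norm_pos_iff.2 h
  rw [pk, ← h2]
  field_simp

/-- The Poisson mean of a rotated Poisson kernel. -/
lemma integral_pk_mul_pk_rotate {w z l : ℂ} (hw : ‖w‖ < 1) (hz : ‖z‖ < 1) (hl : ‖l‖ = 1) :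
    ∫ t, pk w (bpt t) * pk (bpt (-t) * z) l ∂cm = pk ((starRingEnd ℂ) w * z) l := by
  have hne : ∀ x : ℂ, ‖x‖ ≤ 1 → (starRingEnd ℂ) l - x * (starRingEnd ℂ) z ≠ 0 := by
    intro x hx
    refine sub_ne_zero_of_norm ?_ (by simpa using hl)
    rw [norm_mul, RCLike.norm_conj]
    nlinarith [norm_nonneg x, norm_nonneg z]
  have hG : DiffContOnCl ℂ (fun x : ℂ => ((starRingEnd ℂ) l + x * (starRingEnd ℂ) z) /
      ((starRingEnd ℂ) l - x * (starRingEnd ℂ) z)) (ball 0 1) := by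
    apply DifferentiableOn.diffContOnCl
    rw [closure_ball _ one_ne_zero]
    exact DifferentiableOn.div (by fun_prop) (by fun_prop) fun x hx => hne x (by simpa using hx)
  have key : ∀ x : ℂ, ‖x‖ ≤ 1 → (((starRingEnd ℂ) l + x * (starRingEnd ℂ) z) /
      ((starRingEnd ℂ) l - x * (starRingEnd ℂ) z)).re = pk ((starRingEnd ℂ) x * z) l := by
    intro x hx
    rw [pk_eq_re hl, ← Complex.conj_re]
    · simp
    · rw [norm_mul, RCLike.norm_conj]
      nlinarith [norm_nonneg x, norm_nonneg z]
  have h := poisson_formula_re hG hw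
  rw [key w hw.le] at h
  rw [← h]
  congr 1
  ext t
  rw [key _ (norm_bpt t).le, bpt_neg]

lemma norm_bpt_mul (t : ℝ) (z : ℂ) : ‖bpt t * z‖ = ‖z‖ := by rw [norm_mul, norm_bpt, one_mul]

lemma measurable_pk_bpt (w : ℂ) : Measurable fun t => pk w (bpt t) := by
  unfold pk
  have := continuous_bpt.measurable
  fun_prop

lemma continuous_pk_rotate {z l : ℂ} (hz : ‖z‖ < 1) (hl : ‖l‖ = 1) :
    Continuous fun t => pk (bpt (-t) * z) l := by
  have h : Continuous fun t => bpt (-t) * z :=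
    (continuous_bpt.comp continuous_neg).mul continuous_const
  unfold pk
  refine (continuous_const.sub (h.norm.pow 2)).div ((continuous_const.sub h).norm.pow 2) fun t => ?_
  have := sub_ne_zero_of_norm (w := bpt (-t) * z) (by rwa [norm_bpt_mul]) hl
  positivity

lemma lintegral_pk_mul_bdryKernel_rotate {w z l : ℂ} (hw : ‖w‖ < 1) (hz : ‖z‖ < 1)
    (hl : ‖l‖ = 1) :
    ∫⁻ t, ENNReal.ofReal (pk w (bpt t)) * ENNReal.ofReal (bdryKernel l (bpt (-t) * z)) ∂cm =
      ENNReal.ofReal (bdryKernel l ((starRingEnd ℂ) w * z)) := by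
  simp only [bdryKernel_eq_pk hl]
  rw [← integral_pk_mul_pk_rotate hw hz hl, ofReal_integral_eq_lintegral_ofReal]
  · refine lintegral_congr fun t => ?_
    rw [ENNReal.ofReal_mul (pk_nonneg hw _)]
  · exact integrable_cm ((continuous_pk hw).mul (continuous_pk_rotate hz hl))
  · exact ae_of_all _ fun t => mul_nonneg (pk_nonneg hw _)
      (pk_nonneg (by rwa [norm_bpt_mul]) _)

lemma measurable_bdryKernel_left (z : ℂ) : Measurable fun l => bdryKernel l z := by
  unfold bdryKernel
  fun_prop

lemma lintegral_pk_mul_poissonLInt_rotate {μ : Measure ℂ} [IsFiniteMeasure μ] (hμ : OnCircle μ)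
    {w z : ℂ} (hw : ‖w‖ < 1) (hz : ‖z‖ < 1) :
    ∫⁻ t, ENNReal.ofReal (pk w (bpt t)) * poissonLInt μ (bpt (-t) * z) ∂cm =
      poissonLInt μ ((starRingEnd ℂ) w * z) := by
  have hb := continuous_bpt.measurable
  have hm : Measurable fun p : ℝ × ℂ => ENNReal.ofReal (bdryKernel p.2 (bpt (-p.1) * z)) := by
    have : Measurable fun p : ℝ × ℂ => (p.2, bpt (-p.1) * z) := by fun_prop
    exact (measurable_bdryKernel.comp this).ennreal_ofReal
  have hp := (measurable_pk_bpt w).ennreal_ofReal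
  have h1 : ∀ t, ENNReal.ofReal (pk w (bpt t)) * poissonLInt μ (bpt (-t) * z) =
      ∫⁻ l, ENNReal.ofReal (pk w (bpt t)) * ENNReal.ofReal (bdryKernel l (bpt (-t) * z)) ∂μ := by
    intro t
    rw [lintegral_const_mul, poissonLInt]
    exact (measurable_bdryKernel_left _).ennreal_ofReal
  simp only [h1]
  rw [lintegral_lintegral_swap]
  · refine lintegral_congr_ae ?_
    filter_upwards [ae_norm_eq_one hμ] with l hl
    exact lintegral_pk_mul_bdryKernel_rotate hw hz hl
  · exact ((hp.comp measurable_fst).mul hm).aemeasurable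

lemma lintegral_disc_poissonLInt_ne_top {μ : Measure ℂ} [IsFiniteMeasure μ] (hμ : OnCircle μ) :
    ∫⁻ z in disc, poissonLInt μ z ≠ ⊤ := by
  have h0 : ∀ t, pk 0 (bpt t) = 1 := fun t => by simp [pk, norm_bpt]
  have h1 : ∀ z ∈ disc, ∫⁻ t, poissonLInt μ (bpt (-t) * z) ∂cm = μ univ := by
    intro z hz
    have := lintegral_pk_mul_poissonLInt_rotate hμ (w := 0) (by simp) (mem_disc.1 hz)
    simp only [h0, ENNReal.ofReal_one, one_mul, map_zero, zero_mul] at this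
    rw [this, poissonLInt]
    simp [bdryKernel]
  have h2 : ∫⁻ z in disc, ∫⁻ t, poissonLInt μ (bpt (-t) * z) ∂cm =
      ∫⁻ z in disc, poissonLInt μ z := by
    rw [lintegral_lintegral_swap]
    · simp [lintegral_disc_rotate]
    · have := continuous_bpt.measurable
      exact ((measurable_poissonLInt μ).comp
        (by fun_prop : Measurable fun p : ℂ × ℝ => bpt (-p.2) * p.1)).aemeasurable
  rw [← h2, setLIntegral_congr_fun measurableSet_disc h1]
  simp only [lintegral_const, Measure.restrict_apply_univ]
  exact ENNReal.mul_ne_top (measure_ne_top _ _) measure_ball_lt_top.ne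

lemma diffContOnCl_dilate {G : ℂ → ℂ} (hG : DifferentiableOn ℂ G disc) {a : ℂ} (ha : ‖a‖ < 1) :
    DiffContOnCl ℂ (fun x => G (a * x)) (ball 0 1) := by
  apply DifferentiableOn.diffContOnCl
  rw [closure_ball _ one_ne_zero]
  refine hG.comp (by fun_prop) fun x hx => ?_
  rw [mem_disc, norm_mul]
  have : ‖x‖ ≤ 1 := by simpa using hx
  nlinarith [norm_nonneg a, norm_nonneg x]

lemma ofReal_norm_sq_le_lintegral {G : ℂ → ℂ} (hG : DiffContOnCl ℂ G (ball 0 1)) {w : ℂ}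
    (hw : ‖w‖ < 1) : ENNReal.ofReal (‖G w‖ ^ 2) ≤
      ∫⁻ t, ENNReal.ofReal (pk w (bpt t)) * ENNReal.ofReal (‖G (bpt t)‖ ^ 2) ∂cm := by
  refine (ENNReal.ofReal_le_ofReal (norm_sq_le_poisson hG hw)).trans_eq ?_
  rw [ofReal_integral_eq_lintegral_ofReal]
  · exact lintegral_congr fun t => ENNReal.ofReal_mul (pk_nonneg hw _)
  · exact integrable_cm ((continuous_pk hw).mul ((continuous_comp_bpt hG).norm.pow 2))
  · exact ae_of_all _ fun t => mul_nonneg (pk_nonneg hw _) (by positivity)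

lemma lintegral_dilate_sq_le {μ : Measure ℂ} [IsFiniteMeasure μ] (hμ : OnCircle μ) {G : ℂ → ℂ}
    (hG : DifferentiableOn ℂ G disc) (hGm : Measurable G) {s : ℝ} (hs : 0 < s) (hs1 : s < 1) :
    ENNReal.ofReal (s ^ 2) *
      ∫⁻ z in disc, ENNReal.ofReal (‖G ((s ^ 2 : ℝ) * z)‖ ^ 2) * poissonLInt μ z ≤
      ∫⁻ z in disc, ENNReal.ofReal (‖G z‖ ^ 2) * poissonLInt μ z := by
  have hw : ‖(s : ℂ)‖ < 1 := by simpa [abs_of_pos hs] using hs1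
  have hb := continuous_bpt.measurable
  have hP := measurable_poissonLInt μ
  have hp := (measurable_pk_bpt s).ennreal_ofReal
  have hN : Measurable fun z => ENNReal.ofReal (‖G z‖ ^ 2) := by fun_prop
  have h1 : ∀ z ∈ disc, ENNReal.ofReal (‖G ((s ^ 2 : ℝ) * z)‖ ^ 2) ≤
      ∫⁻ t, ENNReal.ofReal (pk s (bpt t)) * ENNReal.ofReal (‖G (s * (bpt t * z))‖ ^ 2) ∂cm := by
    intro z hz
    have h := ofReal_norm_sq_le_lintegral (diffContOnCl_dilate hG (a := s * z) (by
      rw [norm_mul]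
      have := mem_disc.1 hz
      nlinarith [norm_nonneg z, norm_nonneg (s : ℂ)])) hw
    convert h using 3
    · push_cast; ring_nf
    · ring_nf
  calc _ ≤ ENNReal.ofReal (s ^ 2) * ∫⁻ z in disc, ∫⁻ t, ENNReal.ofReal (pk s (bpt t)) *
          (ENNReal.ofReal (‖G (s * (bpt t * z))‖ ^ 2) * poissonLInt μ z) ∂cm := by
        refine mul_le_mul' le_rfl ?_
        refine setLIntegral_mono' measurableSet_disc fun z hz => ?_
        refine (mul_le_mul' (h1 z hz) le_rfl).trans_eq ?_
        rw [← lintegral_mul_const]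
        · simp only [mul_assoc]
        · exact hp.mul (hN.comp (by fun_prop : Measurable fun t => (s : ℂ) * (bpt t * z)))
    _ = ENNReal.ofReal (s ^ 2) * ∫⁻ t, ∫⁻ z in disc, ENNReal.ofReal (pk s (bpt t)) *
          (ENNReal.ofReal (‖G (s * (bpt t * z))‖ ^ 2) * poissonLInt μ z) ∂volume ∂cm := by
        congr 1
        refine lintegral_lintegral_swap (Measurable.aemeasurable ?_)
        exact (hp.comp measurable_snd).mul ((hN.comp (by fun_prop :
          Measurable fun p : ℂ × ℝ => (s : ℂ) * (bpt p.2 * p.1))).mul (hP.comp measurable_fst))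
    _ = ENNReal.ofReal (s ^ 2) * ∫⁻ t, ∫⁻ z in disc, ENNReal.ofReal (pk s (bpt t)) *
          (ENNReal.ofReal (‖G (s * z)‖ ^ 2) * poissonLInt μ (bpt (-t) * z)) ∂volume ∂cm := by
        congr 1
        refine lintegral_congr fun t => ?_
        rw [← lintegral_disc_rotate t (fun z => ENNReal.ofReal (pk s (bpt t)) *
          (ENNReal.ofReal (‖G (s * z)‖ ^ 2) * poissonLInt μ (bpt (-t) * z)))]
        congr 1
        ext z
        rw [← mul_assoc (bpt (-t)), bpt_neg, ← Complex.normSq_eq_conj_mul_self,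
          Complex.normSq_eq_norm_sq, norm_bpt]
        simp
    _ = ENNReal.ofReal (s ^ 2) * ∫⁻ z in disc, ∫⁻ t, ENNReal.ofReal (pk s (bpt t)) *
          (ENNReal.ofReal (‖G (s * z)‖ ^ 2) * poissonLInt μ (bpt (-t) * z)) ∂cm := by
        congr 1
        refine lintegral_lintegral_swap (Measurable.aemeasurable ?_)
        exact (hp.comp measurable_fst).mul ((hN.comp (by fun_prop :
          Measurable fun p : ℝ × ℂ => (s : ℂ) * p.2)).mul (hP.comp (by fun_prop :
          Measurable fun p : ℝ × ℂ => bpt (-p.1) * p.2)))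
    _ = ENNReal.ofReal (s ^ 2) * ∫⁻ z in disc,
          ENNReal.ofReal (‖G (s * z)‖ ^ 2) * poissonLInt μ (s * z) := by
        congr 1
        refine setLIntegral_congr_fun measurableSet_disc fun z hz => ?_
        have := lintegral_pk_mul_poissonLInt_rotate hμ hw (mem_disc.1 hz)
        rw [Complex.conj_ofReal] at this
        rw [← this, ← lintegral_const_mul]
        · refine lintegral_congr fun t => ?_
          ring
        · exact hp.mul (hP.comp (by fun_prop : Measurable fun t => bpt (-t) * z))
    _ ≤ _ := lintegral_disc_dilate hs hs1.le
        (fun z => ENNReal.ofReal (‖G z‖ ^ 2) * poissonLInt μ z)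

/-- Radial dilation does not increase the Dirichlet integral. -/
lemma dirichletLInt_dilate_le {μ : Measure ℂ} [IsFiniteMeasure μ] (hμ : OnCircle μ) {g : ℂ → ℂ}
    (hg : DifferentiableOn ℂ g disc) {r : ℝ} (hr : 0 < r) (hr1 : r < 1) :
    dirichletLInt μ (fun z => g (r * z)) ≤ dirichletLInt μ g := by
  obtain ⟨s, hs, rfl⟩ : ∃ s : ℝ, 0 < s ∧ s ^ 2 = r := ⟨√r, Real.sqrt_pos.2 hr, Real.sq_sqrt hr.le⟩
  have hs1 : s < 1 := by nlinarith
  have hd : DifferentiableOn ℂ (deriv g) disc := hg.deriv isOpen_disc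
  refine le_trans ?_ (lintegral_dilate_sq_le hμ hd (measurable_deriv g) hs hs1)
  rw [dirichletLInt, ← lintegral_const_mul']
  · refine lintegral_mono fun z => ?_
    beta_reduce
    have : deriv (fun z => g ((s ^ 2 : ℝ) * z)) z = (s ^ 2 : ℝ) * deriv g ((s ^ 2 : ℝ) * z) :=
      deriv_comp_mul_left _ _ _
    rw [this, norm_mul, mul_pow, ENNReal.ofReal_mul (by positivity), ← mul_assoc]
    gcongr
    rw [Complex.norm_real, Real.norm_of_nonneg (by positivity)]
    nlinarith [sq_nonneg s]
  · exact ENNReal.ofReal_ne_top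

/-- The mean square of `f` over the circle of radius `ρ`. -/
def circleMeanSq (f : ℂ → ℂ) (ρ : ℝ) : ℝ := ∫ t, ‖f (ρ * bpt t)‖ ^ 2 ∂cm

lemma mem_hardySet {f : ℂ → ℂ} {x : ℝ} :
    x ∈ hardySet f ↔ ∃ r : ℝ, 0 < r ∧ r < 1 ∧ x = circleMeanSq f r := by
  simp only [hardySet, circleMeanSq, integral_cm, smul_eq_mul, mem_ofPred_eq]

lemma circleMeanSq_le_hardyNormSq {f : ℂ → ℂ} (hf : MemHardy2 f) {ρ : ℝ} (h0 : 0 < ρ)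
    (h1 : ρ < 1) : circleMeanSq f ρ ≤ hardyNormSq f :=
  le_csSup hf.2 (mem_hardySet.2 ⟨ρ, h0, h1, rfl⟩)

lemma hardyNormSq_le {f : ℂ → ℂ} {B : ℝ}
    (h : ∀ ρ : ℝ, 0 < ρ → ρ < 1 → circleMeanSq f ρ ≤ B) : hardyNormSq f ≤ B := by
  refine csSup_le ⟨_, mem_hardySet.2 ⟨1 / 2, by norm_num, by norm_num, rfl⟩⟩ ?_
  intro x hx
  obtain ⟨r, h0, h1, rfl⟩ := mem_hardySet.1 hx
  exact h r h0 h1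

lemma memHardy2_of_le {f : ℂ → ℂ} (hf : DifferentiableOn ℂ f disc) {B : ℝ}
    (h : ∀ ρ : ℝ, 0 < ρ → ρ < 1 → circleMeanSq f ρ ≤ B) : MemHardy2 f := by
  refine ⟨hf, B, ?_⟩
  intro x hx
  obtain ⟨r, h0, h1, rfl⟩ := mem_hardySet.1 hx
  exact h r h0 h1

lemma norm_ofReal_mul_bpt {ρ : ℝ} (h0 : 0 < ρ) (t : ℝ) : ‖(ρ : ℂ) * bpt t‖ = ρ := by
  rw [norm_mul, norm_bpt, mul_one, Complex.norm_real, Real.norm_of_nonneg h0.le]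

lemma continuous_circle {f : ℂ → ℂ} (hf : DifferentiableOn ℂ f disc) {ρ : ℝ} (h0 : 0 < ρ)
    (h1 : ρ < 1) : Continuous fun t => f (ρ * bpt t) :=
  hf.continuousOn.comp_continuous (continuous_const.mul continuous_bpt) fun t => by
    rwa [mem_disc, norm_ofReal_mul_bpt h0]

lemma integrable_circle {f : ℂ → ℂ} (hf : DifferentiableOn ℂ f disc) {ρ : ℝ} (h0 : 0 < ρ)
    (h1 : ρ < 1) : Integrable (fun t => ‖f (ρ * bpt t)‖ ^ 2) cm :=
  integrable_cm ((continuous_circle hf h0 h1).norm.pow 2)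

lemma bpt_add (s t : ℝ) : bpt (s + t) = bpt s * bpt t := by
  simp [bpt, mul_add, Complex.exp_add]

lemma bpt_periodic : Function.Periodic bpt (2 * Real.pi) := by
  intro t
  rw [bpt_add]
  have : bpt (2 * Real.pi) = 1 := by
    rw [bpt]
    push_cast
    rw [mul_comm, Complex.exp_two_pi_mul_I]
  rw [this, mul_one]

lemma integral_cm_rotate (h : ℂ → ℝ) (t : ℝ) :
    ∫ s, h (bpt t * bpt s) ∂cm = ∫ s, h (bpt s) ∂cm := by
  rw [integral_cm, integral_cm]
  congr 1
  simp only [← bpt_add]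
  rw [intervalIntegral.integral_comp_add_left (fun s => h (bpt s)) t]
  have hp : Function.Periodic (fun s => h (bpt s)) (2 * Real.pi) := fun s => by
    simp only [bpt_periodic s]
  have := hp.intervalIntegral_add_eq t 0
  simpa using this

lemma lintegral_lintegral_mul_swap {p : ℝ → ℝ≥0∞} {φ : ℝ → ℝ → ℝ≥0∞} (hp : Measurable p)
    (hφ : Measurable (Function.uncurry φ)) :
    ∫⁻ s, ∫⁻ t, p t * φ s t ∂cm ∂cm = ∫⁻ t, p t * ∫⁻ s, φ s t ∂cm ∂cm := by
  rw [lintegral_lintegral_swap]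
  · refine lintegral_congr fun t => ?_
    rw [lintegral_const_mul]
    exact hφ.of_uncurry_right
  · exact ((hp.comp measurable_snd).mul hφ).aemeasurable

lemma circleMeanSq_mono {f : ℂ → ℂ} (hf : DifferentiableOn ℂ f disc) {ρ ρ' : ℝ} (h0 : 0 < ρ)
    (h : ρ ≤ ρ') (h1 : ρ' < 1) : circleMeanSq f ρ ≤ circleMeanSq f ρ' := by
  rcases h.eq_or_lt with rfl | hlt
  · exact le_rfl
  have h0' := h0.trans hlt
  have hb := continuous_bpt.measurable
  set q : ℝ := ρ / ρ' with hq
  have hq0 : 0 < q := by positivity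
  have hw : ‖(q : ℂ)‖ < 1 := by
    rw [Complex.norm_real, Real.norm_of_nonneg hq0.le]
    exact (div_lt_one h0').2 hlt
  have hqρ : (ρ' : ℂ) * q = ρ := by
    rw [← Complex.ofReal_mul, hq, mul_div_cancel₀ _ h0'.ne']
  have hoR : ∀ {a : ℝ}, 0 < a → a < 1 → ENNReal.ofReal (circleMeanSq f a) =
      ∫⁻ t, ENNReal.ofReal (‖f (a * bpt t)‖ ^ 2) ∂cm := fun ha ha1 =>
    ofReal_integral_eq_lintegral_ofReal (integrable_circle hf ha ha1)
      (ae_of_all _ fun t => by positivity)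
  have hcont : Continuous fun p : ℝ × ℝ => ‖f (ρ' * (bpt p.1 * bpt p.2))‖ ^ 2 := by
    refine (hf.continuousOn.comp_continuous (continuous_const.mul
      ((continuous_bpt.comp continuous_fst).mul (continuous_bpt.comp continuous_snd)))
      fun p => ?_).norm.pow 2
    change (ρ' : ℂ) * (bpt p.1 * bpt p.2) ∈ disc
    rwa [← bpt_add, mem_disc, norm_ofReal_mul_bpt h0']
  have hmeas : Measurable (Function.uncurry fun s t : ℝ =>
      ENNReal.ofReal (‖f (ρ' * (bpt t * bpt s))‖ ^ 2)) := by
    have h := hcont.measurable.ennreal_ofReal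
    simp only [mul_comm (bpt _) (bpt _)] at h ⊢
    exact h
  have h2 : ∀ s, ENNReal.ofReal (‖f (ρ * bpt s)‖ ^ 2) ≤
      ∫⁻ t, ENNReal.ofReal (pk q (bpt t)) *
        ENNReal.ofReal (‖f (ρ' * (bpt t * bpt s))‖ ^ 2) ∂cm := by
    intro s
    have h := ofReal_norm_sq_le_lintegral (diffContOnCl_dilate hf (a := ρ' * bpt s) (by
      rwa [norm_ofReal_mul_bpt h0'])) hw
    convert h using 3
    · rw [← hqρ]; ring_nf
    · ring_nf
  have h3 : ENNReal.ofReal (circleMeanSq f ρ) ≤ ENNReal.ofReal (circleMeanSq f ρ') := by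
    rw [hoR h0 (hlt.trans h1)]
    calc _ ≤ ∫⁻ s, ∫⁻ t, ENNReal.ofReal (pk q (bpt t)) *
          ENNReal.ofReal (‖f (ρ' * (bpt t * bpt s))‖ ^ 2) ∂cm ∂cm := lintegral_mono h2
      _ = ∫⁻ t, ENNReal.ofReal (pk q (bpt t)) *
          ∫⁻ s, ENNReal.ofReal (‖f (ρ' * (bpt t * bpt s))‖ ^ 2) ∂cm ∂cm :=
        lintegral_lintegral_mul_swap (measurable_pk_bpt q).ennreal_ofReal hmeas
      _ = ∫⁻ t, ENNReal.ofReal (pk q (bpt t)) * ENNReal.ofReal (circleMeanSq f ρ') ∂cm := by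
        refine lintegral_congr fun t => ?_
        congr 1
        have hci : Continuous fun s => ‖f (ρ' * (bpt t * bpt s))‖ ^ 2 :=
          hcont.comp (g := fun p : ℝ × ℝ => ‖f (ρ' * (bpt p.1 * bpt p.2))‖ ^ 2)
            (f := fun s => (t, s)) (by fun_prop)
        rw [← ofReal_integral_eq_lintegral_ofReal (integrable_cm hci)
            (ae_of_all _ fun s => by positivity),
          integral_cm_rotate (fun z => ‖f (ρ' * z)‖ ^ 2), circleMeanSq]
      _ = _ := by
        rw [lintegral_mul_const _ (measurable_pk_bpt q).ennreal_ofReal,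
          ← ofReal_integral_eq_lintegral_ofReal (integrable_cm (continuous_pk hw))
            (ae_of_all _ fun t => pk_nonneg hw _), integral_pk hw, ENNReal.ofReal_one, one_mul]
  refine (ENNReal.ofReal_le_ofReal_iff ?_).1 h3
  exact integral_nonneg fun t => by positivity

lemma norm_sq_zero_le_hardyNormSq {f : ℂ → ℂ} (hf : MemHardy2 f) :
    ‖f 0‖ ^ 2 ≤ hardyNormSq f := by
  refine le_trans ?_ (circleMeanSq_le_hardyNormSq hf (ρ := 1 / 2) (by norm_num) (by norm_num))
  have := norm_sq_le_poisson (diffContOnCl_dilate hf.1 (a := ((1 / 2 : ℝ) : ℂ))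
    (by rw [Complex.norm_real]; norm_num)) (w := 0) (by simp)
  simpa [pk, norm_bpt, circleMeanSq] using this

lemma circleMeanSq_le_of_bound {f : ℂ → ℂ} (hf : DifferentiableOn ℂ f disc) {A : ℝ}
    (hA : ∀ z ∈ disc, ‖f z‖ ≤ A) {ρ : ℝ} (h0 : 0 < ρ) (h1 : ρ < 1) :
    circleMeanSq f ρ ≤ A ^ 2 := by
  have h := integral_mono (integrable_circle hf h0 h1) (integrable_const (A ^ 2)) (fun t => by
    have := hA (ρ * bpt t) (by rwa [mem_disc, norm_ofReal_mul_bpt h0])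
    show ‖f (ρ * bpt t)‖ ^ 2 ≤ A ^ 2
    gcongr)
  simpa [circleMeanSq] using h

lemma norm_add_sq_le_two (a b : ℂ) : ‖a + b‖ ^ 2 ≤ 2 * ‖a‖ ^ 2 + 2 * ‖b‖ ^ 2 := by
  have := norm_add_le a b
  nlinarith [sq_nonneg (‖a‖ - ‖b‖), norm_nonneg (a + b)]

lemma circleMeanSq_add_le {f g : ℂ → ℂ} (hf : DifferentiableOn ℂ f disc)
    (hg : DifferentiableOn ℂ g disc) {ρ : ℝ} (h0 : 0 < ρ) (h1 : ρ < 1) :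
    circleMeanSq (fun z => f z + g z) ρ ≤ 2 * circleMeanSq f ρ + 2 * circleMeanSq g ρ := by
  simp only [circleMeanSq]
  rw [← integral_const_mul, ← integral_const_mul, ← integral_add
    ((integrable_circle hf h0 h1).const_mul 2) ((integrable_circle hg h0 h1).const_mul 2)]
  refine integral_mono (integrable_circle (hf.fun_add hg) h0 h1)
    (((integrable_circle hf h0 h1).const_mul 2).add ((integrable_circle hg h0 h1).const_mul 2)) ?_
  exact fun t => norm_add_sq_le_two _ _

lemma parallelogram (a b : ℂ) : ‖a - b‖ ^ 2 + ‖a + b‖ ^ 2 = 2 * ‖a‖ ^ 2 + 2 * ‖b‖ ^ 2 := by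
  have := parallelogram_law_with_norm ℝ a b
  nlinarith

lemma circleMeanSq_parallelogram {f g : ℂ → ℂ} (hf : DifferentiableOn ℂ f disc)
    (hg : DifferentiableOn ℂ g disc) {ρ : ℝ} (h0 : 0 < ρ) (h1 : ρ < 1) :
    circleMeanSq (fun z => f z - g z) ρ + circleMeanSq (fun z => f z + g z) ρ =
      2 * circleMeanSq f ρ + 2 * circleMeanSq g ρ := by
  simp only [circleMeanSq]
  rw [← integral_const_mul, ← integral_const_mul, ← integral_add
    ((integrable_circle hf h0 h1).const_mul 2) ((integrable_circle hg h0 h1).const_mul 2),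
    ← integral_add (integrable_circle (hf.fun_sub hg) h0 h1) (integrable_circle (hf.fun_add hg) h0 h1)]
  simp only [parallelogram]

lemma differentiableOn_dilate {f : ℂ → ℂ} (hf : DifferentiableOn ℂ f disc) {r : ℝ} (h0 : 0 < r)
    (h1 : r < 1) : DifferentiableOn ℂ (fun z => f (r * z)) disc := by
  refine hf.comp (by fun_prop) fun z hz => ?_
  rw [mem_disc] at *
  rw [norm_mul, Complex.norm_real, Real.norm_of_nonneg h0.le]
  nlinarith [norm_nonneg z]

lemma circleMeanSq_dilate (f : ℂ → ℂ) (r ρ : ℝ) :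
    circleMeanSq (fun z => f (r * z)) ρ = circleMeanSq f (r * ρ) := by
  simp [circleMeanSq, mul_assoc]

lemma tendsto_circleMeanSq_add_dilate {g : ℂ → ℂ} (hg : DifferentiableOn ℂ g disc) {ρ : ℝ}
    (h0 : 0 < ρ) (h1 : ρ < 1) :
    Tendsto (fun r : ℝ => circleMeanSq (fun z => g z + g (r * z)) ρ) (𝓝[<] 1)
      (𝓝 (4 * circleMeanSq g ρ)) := by
  have hsub : closedBall (0 : ℂ) ρ ⊆ disc := fun z hz => by
    rw [mem_disc]; exact lt_of_le_of_lt (by simpa using hz) h1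
  obtain ⟨B, hB⟩ := (isCompact_closedBall (0 : ℂ) ρ).exists_bound_of_continuousOn
    (hg.continuousOn.mono hsub)
  have hB0 : 0 ≤ B := (norm_nonneg _).trans (hB 0 (by simpa using h0.le))
  have hev : ∀ᶠ r : ℝ in 𝓝[<] 1, r ∈ Ioo (0 : ℝ) 1 := Ioo_mem_nhdsLT one_pos
  have h4 : 4 * circleMeanSq g ρ = ∫ t, ‖g (ρ * bpt t) + g (ρ * bpt t)‖ ^ 2 ∂cm := by
    rw [circleMeanSq, ← integral_const_mul]
    congr 1
    ext t
    rw [← two_mul, norm_mul, mul_pow]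
    norm_num
  rw [h4]
  refine tendsto_integral_filter_of_dominated_convergence (fun _ => (B + B) ^ 2) ?_ ?_
    (integrable_const _) ?_
  · filter_upwards [hev] with r hr
    exact (integrable_circle (hg.fun_add (differentiableOn_dilate hg hr.1 hr.2)) h0
      h1).aestronglyMeasurable
  · filter_upwards [hev] with r hr
    refine ae_of_all _ fun t => ?_
    rw [Real.norm_of_nonneg (by positivity)]
    have e1 := hB (ρ * bpt t) (by simp [norm_bpt, abs_of_pos h0])
    have e2 := hB (r * (ρ * bpt t)) (by
      simp [norm_bpt, abs_of_pos h0, abs_of_pos hr.1]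
      nlinarith [hr.2])
    have e3 := norm_add_le (g (ρ * bpt t)) (g (r * (ρ * bpt t)))
    gcongr
    linarith
  · refine ae_of_all _ fun t => ?_
    have hc : ContinuousAt g (ρ * bpt t) := hg.continuousOn.continuousAt
      (isOpen_disc.mem_nhds (by rwa [mem_disc, norm_ofReal_mul_bpt h0]))
    have hm : Tendsto (fun r : ℝ => (r : ℂ) * (ρ * bpt t)) (𝓝[<] 1) (𝓝 (ρ * bpt t)) := by
      have : Continuous fun r : ℝ => (r : ℂ) * (ρ * bpt t) := by fun_prop
      have h := (this.tendsto 1).mono_left (nhdsWithin_le_nhds (s := Iio 1))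
      simpa using h
    exact ((tendsto_const_nhds.add (hc.tendsto.comp hm)).norm.pow 2)

/-- The dilates of an `H²` function converge to it in `H²`. -/
lemma eventually_circleMeanSq_sub_dilate_le {g : ℂ → ℂ} (hg : MemHardy2 g) {ε : ℝ} (hε : 0 < ε) :
    ∀ᶠ r : ℝ in 𝓝[<] 1, ∀ ρ : ℝ, 0 < ρ → ρ < 1 →
      circleMeanSq (fun z => g z - g (r * z)) ρ ≤ ε := by
  have hne : (hardySet g).Nonempty :=
    ⟨_, mem_hardySet.2 ⟨1 / 2, by norm_num, by norm_num, rfl⟩⟩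
  obtain ⟨x, hx, hlt⟩ := exists_lt_of_lt_csSup hne
    (show hardyNormSq g - ε / 4 < sSup (hardySet g) by
      rw [hardyNormSq]; linarith)
  obtain ⟨ρ₀, h0, h1, rfl⟩ := mem_hardySet.1 hx
  have hev : ∀ᶠ r : ℝ in 𝓝[<] 1, r ∈ Ioo (0 : ℝ) 1 := Ioo_mem_nhdsLT one_pos
  filter_upwards [hev, (tendsto_circleMeanSq_add_dilate hg.1 h0 h1).eventually
    (lt_mem_nhds (show 4 * hardyNormSq g - ε < 4 * circleMeanSq g ρ₀ by linarith))] with r hr hr2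
  intro ρ hρ0 hρ1
  have hd := differentiableOn_dilate hg.1 hr.1 hr.2
  have hm0 : 0 < max ρ ρ₀ := lt_max_of_lt_left hρ0
  have hm1 : max ρ ρ₀ < 1 := max_lt hρ1 h1
  have e1 := circleMeanSq_mono (hg.1.fun_sub hd) hρ0 (le_max_left ρ ρ₀) hm1
  have e2 := circleMeanSq_mono (hg.1.fun_add hd) h0 (le_max_right ρ ρ₀) hm1
  have e3 := circleMeanSq_parallelogram hg.1 hd hm0 hm1
  have e4 := circleMeanSq_le_hardyNormSq hg hm0 hm1
  rw [circleMeanSq_dilate] at e3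
  have e5 := circleMeanSq_le_hardyNormSq hg (mul_pos hr.1 hm0)
    (by nlinarith [hr.1, hr.2] : r * max ρ ρ₀ < 1)
  linarith

lemma differentiableAt_of_disc {f : ℂ → ℂ} (hf : DifferentiableOn ℂ f disc) {z : ℂ}
    (hz : z ∈ disc) : DifferentiableAt ℂ f z := hf.differentiableAt (isOpen_disc.mem_nhds hz)

lemma measurable_dirichletLInt_integrand (μ : Measure ℂ) [IsFiniteMeasure μ] (f : ℂ → ℂ) :
    Measurable fun z => ENNReal.ofReal (‖deriv f z‖ ^ 2) * poissonLInt μ z :=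
  ((measurable_deriv f).norm.pow_const 2).ennreal_ofReal.mul (measurable_poissonLInt μ)

lemma dirichletLInt_parallelogram {μ : Measure ℂ} [IsFiniteMeasure μ] {f g : ℂ → ℂ}
    (hf : DifferentiableOn ℂ f disc) (hg : DifferentiableOn ℂ g disc) :
    dirichletLInt μ (fun z => f z - g z) + dirichletLInt μ (fun z => f z + g z) =
      2 * dirichletLInt μ f + 2 * dirichletLInt μ g := by
  simp only [dirichletLInt]
  rw [← lintegral_const_mul _ (measurable_dirichletLInt_integrand μ f),
    ← lintegral_const_mul _ (measurable_dirichletLInt_integrand μ g),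
    ← lintegral_add_left (measurable_dirichletLInt_integrand μ _),
    ← lintegral_add_left ((measurable_dirichletLInt_integrand μ _).const_mul _)]
  refine setLIntegral_congr_fun measurableSet_disc fun z hz => ?_
  have h1 := differentiableAt_of_disc hf hz
  have h2 := differentiableAt_of_disc hg hz
  rw [deriv_fun_sub h1 h2, deriv_fun_add h1 h2, ← add_mul, ← ENNReal.ofReal_add (by positivity)
    (by positivity), parallelogram, ENNReal.ofReal_add (by positivity) (by positivity),
    ENNReal.ofReal_mul (by positivity), ENNReal.ofReal_mul (by positivity)]
  simp only [ENNReal.ofReal_ofNat]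
  ring

lemma dirichletLInt_add_le {μ : Measure ℂ} [IsFiniteMeasure μ] {f g : ℂ → ℂ}
    (hf : DifferentiableOn ℂ f disc) (hg : DifferentiableOn ℂ g disc) :
    dirichletLInt μ (fun z => f z + g z) ≤ 2 * dirichletLInt μ f + 2 * dirichletLInt μ g := by
  rw [← dirichletLInt_parallelogram hf hg]
  exact le_add_self

lemma memD_iff {μ : Measure ℂ} [IsFiniteMeasure μ] (hμ : OnCircle μ) {f : ℂ → ℂ} :
    MemD μ f ↔ MemHardy2 f ∧ dirichletLInt μ f ≠ ⊤ := by
  rw [MemD, integrableOn_dirichletDensity_iff hμ]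

lemma MemHardy2.add {f g : ℂ → ℂ} (hf : MemHardy2 f) (hg : MemHardy2 g) :
    MemHardy2 (fun z => f z + g z) := by
  refine memHardy2_of_le (B := 2 * hardyNormSq f + 2 * hardyNormSq g) (hf.1.fun_add hg.1) ?_
  intro ρ h0 h1
  have := circleMeanSq_add_le hf.1 hg.1 h0 h1
  have e1 := circleMeanSq_le_hardyNormSq hf h0 h1
  have e2 := circleMeanSq_le_hardyNormSq hg h0 h1
  linarith

lemma hardyNormSq_add_le {f g : ℂ → ℂ} (hf : MemHardy2 f) (hg : MemHardy2 g) :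
    hardyNormSq (fun z => f z + g z) ≤ 2 * hardyNormSq f + 2 * hardyNormSq g := by
  refine hardyNormSq_le fun ρ h0 h1 => ?_
  have := circleMeanSq_add_le hf.1 hg.1 h0 h1
  have e1 := circleMeanSq_le_hardyNormSq hf h0 h1
  have e2 := circleMeanSq_le_hardyNormSq hg h0 h1
  linarith

lemma MemD.add {μ : Measure ℂ} [IsFiniteMeasure μ] (hμ : OnCircle μ) {f g : ℂ → ℂ}
    (hf : MemD μ f) (hg : MemD μ g) : MemD μ (fun z => f z + g z) := by
  rw [memD_iff hμ] at *
  refine ⟨hf.1.add hg.1, ne_top_of_le_ne_top ?_ (dirichletLInt_add_le hf.1.1 hg.1.1)⟩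
  exact ENNReal.add_ne_top.2 ⟨ENNReal.mul_ne_top (by simp) hf.2, ENNReal.mul_ne_top (by simp) hg.2⟩

lemma dNormSq_add_le {μ : Measure ℂ} [IsFiniteMeasure μ] (hμ : OnCircle μ) {f g : ℂ → ℂ}
    (hf : MemD μ f) (hg : MemD μ g) :
    dNormSq μ (fun z => f z + g z) ≤ 2 * dNormSq μ f + 2 * dNormSq μ g := by
  have h1 := hardyNormSq_add_le hf.1 hg.1
  rw [memD_iff hμ] at hf hg
  have ha : 2 * dirichletLInt μ f ≠ ⊤ := ENNReal.mul_ne_top (by simp) hf.2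
  have hb : 2 * dirichletLInt μ g ≠ ⊤ := ENNReal.mul_ne_top (by simp) hg.2
  have h2 := ENNReal.toReal_mono (ENNReal.add_ne_top.2 ⟨ha, hb⟩)
    (dirichletLInt_add_le (μ := μ) hf.1.1 hg.1.1)
  rw [ENNReal.toReal_add ha hb, ENNReal.toReal_mul, ENNReal.toReal_mul, ENNReal.toReal_ofNat] at h2
  simp only [dNormSq, dirichletIntegral_eq hμ]
  have h3 := mul_le_mul_of_nonneg_left h2 (show (0:ℝ) ≤ 1 / Real.pi by positivity)
  linarith

lemma MemD.const_mul {μ : Measure ℂ} {f : ℂ → ℂ} (hf : MemD μ f) (c : ℂ) :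
    MemD μ (fun z => c * f z) := by
  have hd : DifferentiableOn ℂ (fun z => c * f z) disc := hf.1.1.const_mul c
  refine ⟨memHardy2_of_le (B := ‖c‖ ^ 2 * hardyNormSq f) hd fun ρ h0 h1 => ?_, ?_⟩
  · have := circleMeanSq_le_hardyNormSq hf.1 h0 h1
    simp only [circleMeanSq, norm_mul, mul_pow] at this ⊢
    rw [integral_const_mul]
    gcongr
  · refine IntegrableOn.congr_fun (hf.2.const_mul (‖c‖ ^ 2)) (fun z hz => ?_) measurableSet_disc
    simp only [dirichletDensity]
    rw [deriv_const_mul _ (differentiableAt_of_disc hf.1.1 hz), norm_mul]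
    ring

lemma MemD.sub {μ : Measure ℂ} [IsFiniteMeasure μ] (hμ : OnCircle μ) {f g : ℂ → ℂ}
    (hf : MemD μ f) (hg : MemD μ g) : MemD μ (fun z => f z - g z) := by
  convert hf.add hμ (hg.const_mul (-1)) using 2
  ring

/-- A holomorphic function bounded by `A` on the disc with small Dirichlet integral. -/
lemma memD_of_bound {μ : Measure ℂ} [IsFiniteMeasure μ] (hμ : OnCircle μ) {f : ℂ → ℂ}
    (hf : DifferentiableOn ℂ f disc) {A : ℝ} (hA : ∀ z ∈ disc, ‖f z‖ ≤ A)
    (hD : dirichletLInt μ f ≠ ⊤) : MemD μ f :=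
  (memD_iff hμ).2 ⟨memHardy2_of_le hf fun _ h0 h1 => circleMeanSq_le_of_bound hf hA h0 h1, hD⟩

lemma dNormSq_le_of {μ : Measure ℂ} [IsFiniteMeasure μ] (hμ : OnCircle μ) {f : ℂ → ℂ} {A B : ℝ}
    (hA : ∀ ρ : ℝ, 0 < ρ → ρ < 1 → circleMeanSq f ρ ≤ A) (hB : 0 ≤ B)
    (hD : dirichletLInt μ f ≤ ENNReal.ofReal B) : dNormSq μ f ≤ A + B := by
  have h1 := hardyNormSq_le hA
  have h2 : (dirichletLInt μ f).toReal ≤ B := by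
    refine (ENNReal.toReal_mono ENNReal.ofReal_ne_top hD).trans_eq (ENNReal.toReal_ofReal hB)
  rw [dNormSq, dirichletIntegral_eq hμ]
  have h3 : 1 / Real.pi ≤ 1 := by
    rw [div_le_one Real.pi_pos]
    linarith [Real.pi_gt_three]
  have h4 : 1 / Real.pi * (dirichletLInt μ f).toReal ≤ 1 * B := by
    gcongr
  linarith

lemma dirichletLInt_le_of_deriv_bound {μ : Measure ℂ} {f : ℂ → ℂ} {C : ℝ}
    (hC : ∀ z ∈ disc, ‖deriv f z‖ ≤ C) :
    dirichletLInt μ f ≤ ENNReal.ofReal (C ^ 2) * ∫⁻ z in disc, poissonLInt μ z := by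
  rw [← lintegral_const_mul' _ _ ENNReal.ofReal_ne_top]
  refine setLIntegral_mono' measurableSet_disc fun z hz => ?_
  gcongr
  exact hC z hz

lemma memD_of_deriv_bound {μ : Measure ℂ} [IsFiniteMeasure μ] (hμ : OnCircle μ) {f : ℂ → ℂ}
    (hf : DifferentiableOn ℂ f disc) {A C : ℝ} (hA : ∀ z ∈ disc, ‖f z‖ ≤ A)
    (hC : ∀ z ∈ disc, ‖deriv f z‖ ≤ C) : MemD μ f :=
  memD_of_bound hμ hf hA (ne_top_of_le_ne_top
    (ENNReal.mul_ne_top ENNReal.ofReal_ne_top (lintegral_disc_poissonLInt_ne_top hμ))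
    (dirichletLInt_le_of_deriv_bound hC))

lemma tendsto_dirichletLInt_zero {μ : Measure ℂ} [IsFiniteMeasure μ] (hμ : OnCircle μ)
    {f : ℕ → ℂ → ℂ} {C : ℝ} (hC : ∀ n, ∀ z ∈ disc, ‖deriv (f n) z‖ ≤ C)
    (h0 : ∀ z ∈ disc, Tendsto (fun n => deriv (f n) z) atTop (𝓝 0)) :
    Tendsto (fun n => dirichletLInt μ (f n)) atTop (𝓝 0) := by
  have hP := lintegral_disc_poissonLInt_ne_top hμ
  have hae : ∀ᵐ z ∂(volume.restrict disc), poissonLInt μ z < ⊤ :=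
    ae_lt_top (measurable_poissonLInt μ) hP
  have h := tendsto_lintegral_of_dominated_convergence (μ := volume.restrict disc)
    (F := fun n z => ENNReal.ofReal (‖deriv (f n) z‖ ^ 2) * poissonLInt μ z) (f := fun _ => 0)
    (fun z => ENNReal.ofReal (C ^ 2) * poissonLInt μ z)
    (fun n => measurable_dirichletLInt_integrand μ (f n)) ?_ ?_ ?_
  · simpa [dirichletLInt] using h
  · intro n
    filter_upwards [ae_restrict_mem measurableSet_disc] with z hz
    gcongr
    exact hC n z hz
  · rw [lintegral_const_mul' _ _ ENNReal.ofReal_ne_top]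
    exact ENNReal.mul_ne_top ENNReal.ofReal_ne_top hP
  · filter_upwards [ae_restrict_mem measurableSet_disc, hae] with z hz hfin
    have h1 : Tendsto (fun n => ENNReal.ofReal (‖deriv (f n) z‖ ^ 2)) atTop (𝓝 0) := by
      have := ENNReal.tendsto_ofReal ((h0 z hz).norm.pow 2)
      simpa using this
    have := ENNReal.Tendsto.mul_const h1 (b := poissonLInt μ z) (Or.inr hfin.ne)
    simpa using this

/-- The dilates of a function of finite Dirichlet integral converge to it along a sequence. -/
lemma eventually_dirichletLInt_sub_dilate_lt {μ : Measure ℂ} [IsFiniteMeasure μ]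
    (hμ : OnCircle μ) {g : ℂ → ℂ} (hg : DifferentiableOn ℂ g disc) (hD : dirichletLInt μ g ≠ ⊤)
    {r : ℕ → ℝ} (hr : ∀ j, r j ∈ Ioo (0 : ℝ) 1) (hr1 : Tendsto r atTop (𝓝 1)) {ε : ℝ≥0∞}
    (hε : 0 < ε) : ∀ᶠ j in atTop, dirichletLInt μ (fun z => g z - g (r j * z)) < ε := by
  have hd := fun j => differentiableOn_dilate hg (hr j).1 (hr j).2
  have hsum : ∀ j, dirichletLInt μ (fun z => g z - g (r j * z)) +
      dirichletLInt μ (fun z => g z + g (r j * z)) ≤ 4 * dirichletLInt μ g := by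
    intro j
    rw [dirichletLInt_parallelogram hg (hd j)]
    have := dirichletLInt_dilate_le hμ hg (hr j).1 (hr j).2
    calc _ ≤ 2 * dirichletLInt μ g + 2 * dirichletLInt μ g := by gcongr
      _ = _ := by ring
  have h4 : 4 * dirichletLInt μ g ≠ ⊤ := ENNReal.mul_ne_top (by simp) hD
  have hfatou : 4 * dirichletLInt μ g ≤
      liminf (fun j => dirichletLInt μ (fun z => g z + g (r j * z))) atTop := by
    refine le_trans ?_ (lintegral_liminf_le fun j => measurable_dirichletLInt_integrand μ _)
    rw [dirichletLInt, ← lintegral_const_mul _ (measurable_dirichletLInt_integrand μ g)]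
    refine setLIntegral_mono' measurableSet_disc fun z hz => ?_
    have hda := differentiableAt_of_disc hg hz
    have hcd : ContinuousAt (deriv g) z :=
      ((hg.deriv isOpen_disc).continuousOn).continuousAt (isOpen_disc.mem_nhds hz)
    have hrc : Tendsto (fun j => (r j : ℂ)) atTop (𝓝 1) := by
      have := (Complex.continuous_ofReal.tendsto 1).comp hr1
      rwa [Complex.ofReal_one] at this
    have hlim : Tendsto (fun j => deriv (fun z => g z + g (r j * z)) z) atTop
        (𝓝 (2 * deriv g z)) := by
      have e : ∀ j, deriv (fun z => g z + g (r j * z)) z =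
          deriv g z + r j * deriv g (r j * z) := fun j => by
        rw [deriv_fun_add hda (differentiableAt_of_disc (hd j) hz)]
        congr 1
        exact deriv_comp_mul_left _ _ _
      simp only [e, two_mul]
      have h1 : Tendsto (fun j => (r j : ℂ) * z) atTop (𝓝 z) := by
        simpa using hrc.mul_const z
      have := tendsto_const_nhds (x := deriv g z) |>.add (hrc.mul (hcd.tendsto.comp h1))
      simpa using this
    have h2 := ENNReal.tendsto_ofReal (hlim.norm.pow 2)
    have h3 : ENNReal.ofReal (‖2 * deriv g z‖ ^ 2) = 4 * ENNReal.ofReal (‖deriv g z‖ ^ 2) := by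
      rw [norm_mul, mul_pow, ENNReal.ofReal_mul (by positivity)]
      norm_num
    rw [h3] at h2
    rcases eq_or_ne (ENNReal.ofReal (‖deriv g z‖ ^ 2)) 0 with h0 | h0
    · simp [h0]
    · have h5 := ENNReal.Tendsto.mul_const h2 (b := poissonLInt μ z) (Or.inl (by simpa using h0))
      rw [h5.liminf_eq, mul_assoc]
  rcases eq_or_ne (dirichletLInt μ g) 0 with h0 | h0
  · refine Eventually.of_forall fun j => ?_
    have := hsum j
    rw [h0, mul_zero] at this
    exact (le_self_add.trans this).trans_lt hε
  · have hlt : 4 * dirichletLInt μ g - ε < 4 * dirichletLInt μ g :=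
      ENNReal.sub_lt_self h4 (by simpa using h0) hε.ne'
    filter_upwards [eventually_lt_of_lt_liminf (hlt.trans_le hfatou)] with j hj
    by_contra! h
    have h1 : ε ≠ ⊤ := ne_top_of_le_ne_top h4 (h.trans (le_self_add.trans (hsum j)))
    refine hj.not_ge (ENNReal.le_sub_of_add_le_right h1 ?_)
    refine le_trans ?_ (hsum j)
    rw [add_comm]
    gcongr

lemma dNormSq_le_of_deriv_bound {μ : Measure ℂ} [IsFiniteMeasure μ] (hμ : OnCircle μ)
    {f : ℂ → ℂ} (hf : DifferentiableOn ℂ f disc) {A C : ℝ} (hA : ∀ z ∈ disc, ‖f z‖ ≤ A)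
    (hC : ∀ z ∈ disc, ‖deriv f z‖ ≤ C) :
    dNormSq μ f ≤ A ^ 2 + C ^ 2 * (∫⁻ z in disc, poissonLInt μ z).toReal := by
  refine dNormSq_le_of hμ (fun ρ h0 h1 => circleMeanSq_le_of_bound hf hA h0 h1) (by positivity) ?_
  rw [ENNReal.ofReal_mul (by positivity), ENNReal.ofReal_toReal (lintegral_disc_poissonLInt_ne_top hμ)]
  exact dirichletLInt_le_of_deriv_bound hC

/-- Taylor polynomials approximate together with their derivatives on the closed unit disc. -/
lemma exists_polynomial_approx {Q : ℂ → ℂ} {R : ℝ} (hR : 1 < R)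
    (hQ : DifferentiableOn ℂ Q (ball 0 R)) {η : ℝ} (hη : 0 < η) :
    ∃ q : Polynomial ℂ, ∀ z ∈ disc, ‖Q z - q.eval z‖ ≤ η ∧
      ‖deriv (fun z => Q z - q.eval z) z‖ ≤ η := by
  obtain ⟨S, hS1, hSR⟩ := exists_between hR
  have hS0 : 0 < S := by linarith
  lift S to NNReal using hS0.le
  have hp := (hQ.mono (closedBall_subset_ball hSR)).hasFPowerSeriesOnBall (by exact_mod_cast hS0)
  set p := cauchyPowerSeries Q 0 S with hpdef
  let q : ℕ → Polynomial ℂ := fun k => ∑ i ∈ Finset.range k, Polynomial.C (p.coeff i) * Polynomial.X ^ i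
  have hq : ∀ k z, (q k).eval z = p.partialSum k z := by
    intro k z
    simp only [q, Polynomial.eval_finsetSum, FormalMultilinearSeries.partialSum,
      FormalMultilinearSeries.apply_eq_pow_smul_coeff, smul_eq_mul, Polynomial.eval_mul,
      Polynomial.eval_C, Polynomial.eval_pow, Polynomial.eval_X]
    exact Finset.sum_congr rfl fun i _ => mul_comm _ _
  have hloc : TendstoLocallyUniformlyOn (fun k z => (q k).eval z) Q atTop (ball 0 S) := by
    have h := hp.tendstoLocallyUniformlyOn'
    simp only [sub_zero, ← hq] at h
    rwa [Metric.eball_coe] at h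
  have hsub : closedBall (0 : ℂ) 1 ⊆ ball 0 S := closedBall_subset_ball hS1
  have hQS : DifferentiableOn ℂ Q (ball 0 S) := hQ.mono (ball_subset_ball hSR.le)
  have hdloc := hloc.deriv (Eventually.of_forall fun k => (q k).differentiable.differentiableOn)
    isOpen_ball
  have h1 := (tendstoLocallyUniformlyOn_iff_forall_isCompact isOpen_ball).1 hloc _ hsub
    (isCompact_closedBall _ _)
  have h2 := (tendstoLocallyUniformlyOn_iff_forall_isCompact isOpen_ball).1 hdloc _ hsub
    (isCompact_closedBall _ _)
  rw [Metric.tendstoUniformlyOn_iff] at h1 h2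
  obtain ⟨k, hk1, hk2⟩ := ((h1 η hη).and (h2 η hη)).exists
  refine ⟨q k, fun z hz => ?_⟩
  have hz' : z ∈ closedBall (0 : ℂ) 1 := ball_subset_closedBall hz
  constructor
  · rw [← dist_eq_norm]
    exact (hk1 z hz').le
  · rw [deriv_fun_sub (hQS.differentiableAt (isOpen_ball.mem_nhds (hsub hz')))
      (q k).differentiable.differentiableAt, ← dist_eq_norm]
    exact (hk2 z hz').le

lemma norm_one_sub_pow_le {b : ℂ} (hb : ‖b‖ ≤ 1) (n : ℕ) : ‖1 - b ^ n‖ ≤ n * ‖1 - b‖ := by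
  induction n with
  | zero => simp
  | succ k ih =>
    have h : 1 - b ^ (k + 1) = (1 - b ^ k) + b ^ k * (1 - b) := by ring
    rw [h]
    refine (norm_add_le _ _).trans ?_
    rw [norm_mul, norm_pow]
    have : ‖b‖ ^ k * ‖1 - b‖ ≤ 1 * ‖1 - b‖ := by
      gcongr
      exact pow_le_one₀ (norm_nonneg _) hb
    push_cast
    linarith

lemma norm_sub_le_norm_sub_dilate {z ζ : ℂ} (hz : ‖z‖ ≤ 1) (hζ : ‖ζ‖ = 1) {δ : ℝ} (hδ : 0 ≤ δ) :
    ‖z - ζ‖ ≤ ‖z - (1 + δ) * ζ‖ := by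
  have h1 : (z * (starRingEnd ℂ) ζ).re ≤ 1 := by
    refine (Complex.re_le_norm _).trans ?_
    rw [norm_mul, RCLike.norm_conj, hζ, mul_one]
    exact hz
  have e1 : ‖z - ζ‖ ^ 2 = ‖z‖ ^ 2 + 1 - 2 * (z * (starRingEnd ℂ) ζ).re := by
    rw [Complex.sq_norm, Complex.normSq_sub, Complex.normSq_eq_norm_sq, Complex.normSq_eq_norm_sq,
      hζ]
    ring
  have e2 : ‖z - (1 + δ) * ζ‖ ^ 2 = ‖z‖ ^ 2 + (1 + δ) ^ 2 -
      2 * ((1 + δ) * (z * (starRingEnd ℂ) ζ).re) := by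
    rw [Complex.sq_norm, Complex.normSq_sub, Complex.normSq_eq_norm_sq, Complex.normSq_eq_norm_sq,
      norm_mul, hζ]
    have : (1 + (δ : ℂ)) = ((1 + δ : ℝ) : ℂ) := by push_cast; ring
    rw [this, map_mul, Complex.conj_ofReal, Complex.norm_real, Real.norm_of_nonneg (by linarith),
      mul_left_comm, Complex.re_ofReal_mul]
    ring
  refine le_of_sq_le_sq ?_ (norm_nonneg _)
  rw [e1, e2]
  nlinarith

lemma le_norm_sub_dilate {z ζ : ℂ} (hz : ‖z‖ ≤ 1) (hζ : ‖ζ‖ = 1) {δ : ℝ} (hδ : 0 ≤ δ) :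
    δ ≤ ‖z - (1 + δ) * ζ‖ := by
  have h1 := norm_sub_norm_le ((1 + δ) * ζ) z
  have : (1 + (δ : ℂ)) = ((1 + δ : ℝ) : ℂ) := by push_cast; ring
  rw [norm_sub_rev, norm_mul, hζ, this, Complex.norm_real, Real.norm_of_nonneg (by linarith)] at h1
  rw [this]
  linarith

/-- The remainder `G - (z - ζ)ⁿ G / (z - (1 + δ) ζ)ⁿ`. -/
def shiftRemainder (G : ℂ → ℂ) (ζ : ℂ) (n : ℕ) (δ : ℝ) (z : ℂ) : ℂ :=
  G z - (z - ζ) ^ n * (G z / (z - (1 + δ) * ζ) ^ n)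

lemma shiftRemainder_bounds {G : ℂ → ℂ} {ζ : ℂ} (hζ : ‖ζ‖ = 1) (n : ℕ) {C : ℝ}
    (hG : DifferentiableOn ℂ G disc) (hC : ∀ z ∈ disc, ‖deriv G z‖ ≤ C)
    (hL : ∀ z ∈ disc, ‖G z‖ ≤ C * ‖z - ζ‖) {δ : ℝ} (hδ : 0 < δ) {z : ℂ} (hz : z ∈ disc) :
    DifferentiableAt ℂ (shiftRemainder G ζ n δ) z ∧
    ‖shiftRemainder G ζ n δ z‖ ≤ C * n * δ ∧
    ‖deriv (shiftRemainder G ζ n δ) z‖ ≤ 2 * n * C * (δ / ‖z - (1 + δ) * ζ‖) := by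
  have hC0 : 0 ≤ C := (norm_nonneg _).trans (hC z hz)
  have hz1 : ‖z‖ ≤ 1 := (mem_disc.1 hz).le
  have hle := norm_sub_le_norm_sub_dilate hz1 hζ hδ.le
  have hδle := le_norm_sub_dilate hz1 hζ hδ.le
  have hpos : 0 < ‖z - (1 + δ) * ζ‖ := hδ.trans_le hδle
  have hne : z - (1 + δ) * ζ ≠ 0 := norm_pos_iff.1 hpos
  set b : ℂ := (z - ζ) / (z - (1 + δ) * ζ) with hb
  have hb1 : ‖b‖ ≤ 1 := by
    rw [hb, norm_div]
    exact div_le_one_of_le₀ hle hpos.le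
  have h1b : ‖1 - b‖ = δ / ‖z - (1 + δ) * ζ‖ := by
    have : 1 - b = -(δ * ζ) / (z - (1 + δ) * ζ) := by
      rw [hb, eq_div_iff hne, sub_mul, div_mul_cancel₀ _ hne]
      ring
    rw [this, norm_div, norm_neg, norm_mul, hζ, Complex.norm_real, Real.norm_of_nonneg hδ.le,
      mul_one]
  have hpow := norm_one_sub_pow_le hb1 n
  rw [h1b] at hpow
  have hrepr : shiftRemainder G ζ n δ = fun z => G z * (1 - ((z - ζ) / (z - (1 + δ) * ζ)) ^ n) := by
    ext w
    rw [shiftRemainder, div_pow]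
    ring
  have hbd : HasDerivAt (fun z => (z - ζ) / (z - (1 + δ) * ζ))
      (-(δ * ζ) / (z - (1 + δ) * ζ) ^ 2) z := by
    have h := ((hasDerivAt_id' z).sub_const ζ).fun_div
      ((hasDerivAt_id' z).sub_const ((1 + δ) * ζ)) hne
    have e : 1 * (z - (1 + δ) * ζ) - (z - ζ) * 1 = -(δ * ζ) := by ring
    rwa [e] at h
  have hd := (differentiableAt_of_disc hG hz).hasDerivAt.mul ((hbd.pow n).const_sub 1)
  rw [hrepr]
  refine ⟨hd.differentiableAt, ?_, ?_⟩
  · rw [norm_mul]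
    calc _ ≤ (C * ‖z - ζ‖) * (n * (δ / ‖z - (1 + δ) * ζ‖)) := by
          gcongr
          exact hL z hz
      _ = C * n * δ * (‖z - ζ‖ / ‖z - (1 + δ) * ζ‖) := by ring
      _ ≤ C * n * δ * 1 := by
          gcongr
          exact div_le_one_of_le₀ hle hpos.le
      _ = _ := mul_one _
  · have hd' := hd.deriv
    simp only [Pi.mul_def, Pi.pow_apply] at hd'
    rw [hd']
    refine (norm_add_le _ _).trans ?_
    have e1 : ‖deriv G z * (1 - b ^ n)‖ ≤ C * (n * (δ / ‖z - (1 + δ) * ζ‖)) := by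
      rw [norm_mul]
      gcongr
      exact hC z hz
    have e2 : ‖G z * -(n * b ^ (n - 1) * (-(δ * ζ) / (z - (1 + δ) * ζ) ^ 2))‖ ≤
        C * (n * (δ / ‖z - (1 + δ) * ζ‖)) := by
      simp only [norm_mul, norm_neg, norm_div, norm_pow, hζ, Complex.norm_real,
        Real.norm_of_nonneg hδ.le, Complex.norm_natCast, mul_one]
      calc _ ≤ (C * ‖z - ζ‖) * (n * 1 * (δ / ‖z - (1 + δ) * ζ‖ ^ 2)) := by
            gcongr
            · exact hL z hz
            · exact pow_le_one₀ (norm_nonneg _) hb1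
        _ = C * n * (δ / ‖z - (1 + δ) * ζ‖) * (‖z - ζ‖ / ‖z - (1 + δ) * ζ‖) := by
            field_simp
        _ ≤ C * n * (δ / ‖z - (1 + δ) * ζ‖) * 1 := by
            gcongr
            exact div_le_one_of_le₀ hle hpos.le
        _ = _ := by ring
    refine (add_le_add e1 e2).trans_eq ?_
    ring

lemma exists_shiftRemainder_small {μ : Measure ℂ} [IsFiniteMeasure μ] (hμ : OnCircle μ)
    {G : ℂ → ℂ} {ζ : ℂ} (hζ : ‖ζ‖ = 1) (n : ℕ) {C : ℝ}
    (hG : DifferentiableOn ℂ G disc) (hC : ∀ z ∈ disc, ‖deriv G z‖ ≤ C)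
    (hL : ∀ z ∈ disc, ‖G z‖ ≤ C * ‖z - ζ‖) {ε : ℝ} (hε : 0 < ε) :
    ∃ δ : ℝ, 0 < δ ∧ MemD μ (shiftRemainder G ζ n δ) ∧ dNormSq μ (shiftRemainder G ζ n δ) ≤ ε := by
  have hC0 : 0 ≤ C := (norm_nonneg _).trans (hC 0 (by simp [disc]))
  let δ : ℕ → ℝ := fun j => 1 / ((j : ℝ) + 1)
  have hδ : ∀ j, 0 < δ j := fun j => by positivity
  have hδ0 : Tendsto δ atTop (𝓝 0) := tendsto_one_div_add_atTop_nhds_zero_nat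
  have hB := fun j z hz => shiftRemainder_bounds hζ n hG hC hL (hδ j) (z := z) hz
  have hdiff : ∀ j, DifferentiableOn ℂ (shiftRemainder G ζ n (δ j)) disc := fun j z hz =>
    (hB j z hz).1.differentiableWithinAt
  have hderiv : ∀ j, ∀ z ∈ disc, ‖deriv (shiftRemainder G ζ n (δ j)) z‖ ≤ 2 * n * C := by
    intro j z hz
    refine (hB j z hz).2.2.trans ?_
    have := div_le_one_of_le₀ (le_norm_sub_dilate (mem_disc.1 hz).le hζ (hδ j).le) (norm_nonneg _)
    calc _ ≤ 2 * n * C * 1 := by gcongr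
      _ = _ := mul_one _
  have hD : Tendsto (fun j => dirichletLInt μ (shiftRemainder G ζ n (δ j))) atTop (𝓝 0) := by
    refine tendsto_dirichletLInt_zero hμ hderiv fun z hz => ?_
    have hne : 0 < ‖z - ζ‖ := by
      rw [norm_sub_rev]
      exact norm_pos_iff.2 (sub_ne_zero_of_norm (mem_disc.1 hz) hζ)
    have hlim : Tendsto (fun j => 2 * n * C * (δ j / ‖z - ζ‖)) atTop (𝓝 0) := by
      simpa using (hδ0.div_const ‖z - ζ‖).const_mul (2 * n * C)
    refine squeeze_zero_norm (fun j => (hB j z hz).2.2.trans ?_) hlim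
    have := norm_sub_le_norm_sub_dilate (mem_disc.1 hz).le hζ (hδ j).le
    have := (hδ j).le
    gcongr
  have hA : Tendsto (fun j => (C * n * δ j) ^ 2) atTop (𝓝 0) := by
    simpa using (hδ0.const_mul (C * n)).pow 2
  obtain ⟨j, h1, h2⟩ := ((hD.eventually (gt_mem_nhds (show (0 : ℝ≥0∞) < ENNReal.ofReal (ε / 2) by
    simpa using hε))).and (hA.eventually (gt_mem_nhds (show (0 : ℝ) < ε / 2 by positivity)))).exists
  refine ⟨δ j, hδ j, memD_of_deriv_bound hμ (hdiff j) (fun z hz => (hB j z hz).2.1) (hderiv j), ?_⟩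
  have := dNormSq_le_of hμ (fun ρ h0 h1 => circleMeanSq_le_of_bound (hdiff j)
    (fun z hz => (hB j z hz).2.1) h0 h1) (by positivity) h1.le
  linarith

lemma exists_polynomial_small {μ : Measure ℂ} [IsFiniteMeasure μ] (hμ : OnCircle μ)
    {Q : ℂ → ℂ} {R : ℝ} (hR : 1 < R) (hQ : DifferentiableOn ℂ Q (ball 0 R))
    {ζ : ℂ} (hζ : ‖ζ‖ = 1) (n : ℕ) {ε : ℝ} (hε : 0 < ε) :
    ∃ q : Polynomial ℂ, MemD μ (fun z => (z - ζ) ^ n * (Q z - q.eval z)) ∧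
      dNormSq μ (fun z => (z - ζ) ^ n * (Q z - q.eval z)) ≤ ε := by
  set I := (∫⁻ z in disc, poissonLInt μ z).toReal with hI
  have hlim : Tendsto (fun η : ℝ => (2 ^ n * η) ^ 2 + ((n * 2 ^ (n - 1) + 2 ^ n) * η) ^ 2 * I)
      (𝓝[>] 0) (𝓝 0) := by
    have hc : Continuous fun η : ℝ =>
      (2 ^ n * η) ^ 2 + ((n * 2 ^ (n - 1) + 2 ^ n) * η) ^ 2 * I := by fun_prop
    have := (hc.tendsto 0).mono_left (nhdsWithin_le_nhds (s := Ioi 0))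
    simpa using this
  obtain ⟨η, h1, hη⟩ := ((hlim.eventually (gt_mem_nhds hε)).and self_mem_nhdsWithin).exists
  obtain ⟨q, hq⟩ := exists_polynomial_approx hR hQ hη
  have hη0 : 0 ≤ η := le_of_lt hη
  have hsub : disc ⊆ ball (0 : ℂ) R := ball_subset_ball hR.le
  have hQd : DifferentiableOn ℂ (fun z => Q z - q.eval z) disc :=
    (hQ.mono hsub).fun_sub q.differentiable.differentiableOn
  have hzz : ∀ z ∈ disc, ‖z - ζ‖ ≤ 2 := fun z hz => by
    have := norm_sub_le z ζ
    have := mem_disc.1 hz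
    linarith
  have hd : DifferentiableOn ℂ (fun z => (z - ζ) ^ n * (Q z - q.eval z)) disc :=
    DifferentiableOn.fun_mul (by fun_prop) hQd
  have hA : ∀ z ∈ disc, ‖(z - ζ) ^ n * (Q z - q.eval z)‖ ≤ 2 ^ n * η := fun z hz => by
    rw [norm_mul, norm_pow]
    gcongr
    · exact hzz z hz
    · exact (hq z hz).1
  have hC : ∀ z ∈ disc, ‖deriv (fun z => (z - ζ) ^ n * (Q z - q.eval z)) z‖ ≤
      (n * 2 ^ (n - 1) + 2 ^ n) * η := fun z hz => by
    have e := (((hasDerivAt_id z).sub_const ζ).pow n).mul (differentiableAt_of_disc hQd hz).hasDerivAt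
    have e' := e.deriv
    simp only [Pi.mul_def, Pi.pow_def, id, mul_one] at e'
    rw [e']
    refine (norm_add_le _ _).trans ?_
    simp only [norm_mul, norm_pow, Complex.norm_natCast]
    rw [add_mul]
    have a1 := hzz z hz
    have a2 := hq z hz
    gcongr
    · exact a2.1
    · exact a2.2
  exact ⟨q, memD_of_deriv_bound hμ hd hA hC, (dNormSq_le_of_deriv_bound hμ hd hA hC).trans h1.le⟩

lemma exists_bounds_of_vanish {G : ℂ → ℂ} {ζ : ℂ} (hζ : ‖ζ‖ = 1) {R : ℝ} (hR : 1 < R)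
    (hG : DifferentiableOn ℂ G (ball 0 R)) (h0 : G ζ = 0) :
    ∃ C : ℝ, (∀ z ∈ disc, ‖deriv G z‖ ≤ C) ∧ ∀ z ∈ disc, ‖G z‖ ≤ C * ‖z - ζ‖ := by
  have hsub : closedBall (0 : ℂ) 1 ⊆ ball 0 R := closedBall_subset_ball hR
  obtain ⟨C, hC⟩ := (isCompact_closedBall (0 : ℂ) 1).exists_bound_of_continuousOn
    ((hG.deriv isOpen_ball).continuousOn.mono hsub)
  refine ⟨C, fun z hz => hC z (ball_subset_closedBall hz), fun z hz => ?_⟩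
  have h := (convex_closedBall (0 : ℂ) 1).norm_image_sub_le_of_norm_deriv_le
    (fun x hx => hG.differentiableAt (isOpen_ball.mem_nhds (hsub hx))) hC
    (show ζ ∈ closedBall (0 : ℂ) 1 by simp [hζ]) (ball_subset_closedBall hz)
  rwa [h0, sub_zero] at h

/-- A function holomorphic across the circle and vanishing at `ζ` is approximable by polynomial
multiples of `(z - ζ)ⁿ`. -/
lemma exists_polynomial_mul_pow_approx {μ : Measure ℂ} [IsFiniteMeasure μ] (hμ : OnCircle μ)
    {G : ℂ → ℂ} {ζ : ℂ} (hζ : ‖ζ‖ = 1) (n : ℕ) {R : ℝ} (hR : 1 < R)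
    (hG : DifferentiableOn ℂ G (ball 0 R)) (h0 : G ζ = 0) {ε : ℝ} (hε : 0 < ε) :
    ∃ q : Polynomial ℂ, MemD μ (fun z => G z - q.eval z * (z - ζ) ^ n) ∧
      dNormSq μ (fun z => G z - q.eval z * (z - ζ) ^ n) ≤ 4 * ε := by
  obtain ⟨C, hC, hL⟩ := exists_bounds_of_vanish hζ hR hG h0
  obtain ⟨δ, hδ, hm, hle⟩ := exists_shiftRemainder_small hμ hζ n
    (hG.mono (ball_subset_ball hR.le)) hC hL hε
  have hQ : DifferentiableOn ℂ (fun z => G z / (z - (1 + δ) * ζ) ^ n) (ball 0 (min R (1 + δ))) := by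
    refine (hG.mono (ball_subset_ball (min_le_left _ _))).fun_div (by fun_prop) fun z hz => ?_
    refine pow_ne_zero _ fun h => ?_
    rw [mem_ball_zero_iff, sub_eq_zero.1 h, norm_mul, hζ, mul_one] at hz
    have e : (1 + (δ : ℂ)) = ((1 + δ : ℝ) : ℂ) := by push_cast; ring
    rw [e, Complex.norm_real, Real.norm_of_nonneg (by linarith)] at hz
    exact absurd (hz.trans_le (min_le_right _ _)) (lt_irrefl _)
  obtain ⟨q, hqm, hqle⟩ := exists_polynomial_small hμ (lt_min hR (by linarith)) hQ hζ n hε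
  have e : (fun z => G z - q.eval z * (z - ζ) ^ n) = fun z => shiftRemainder G ζ n δ z +
      (z - ζ) ^ n * (G z / (z - (1 + δ) * ζ) ^ n - q.eval z) := by
    ext z
    rw [shiftRemainder]
    ring
  refine ⟨q, ?_⟩
  rw [e]
  refine ⟨hm.add hμ hqm, (dNormSq_add_le hμ hm hqm).trans ?_⟩
  linarith

lemma memD_dilate {μ : Measure ℂ} [IsFiniteMeasure μ] (hμ : OnCircle μ) {g : ℂ → ℂ}
    (hg : MemD μ g) {r : ℝ} (h0 : 0 < r) (h1 : r < 1) : MemD μ (fun z => g (r * z)) := by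
  have hg' := (memD_iff hμ).1 hg
  refine (memD_iff hμ).2 ⟨memHardy2_of_le (differentiableOn_dilate hg.1.1 h0 h1)
    (B := hardyNormSq g) fun ρ hρ0 hρ1 => ?_,
    ne_top_of_le_ne_top hg'.2 (dirichletLInt_dilate_le hμ hg.1.1 h0 h1)⟩
  rw [circleMeanSq_dilate]
  exact circleMeanSq_le_hardyNormSq hg.1 (by positivity) (by nlinarith)

/-- Every function of `D(μ)` with radial limit `0` at `ζ` is in the closed span of `(z - ζ)ⁿ`. -/
lemma mem_closedSpan_of_hasRadialLimitAt {μ : Measure ℂ} [IsFiniteMeasure μ] (hμ : OnCircle μ)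
    {ζ : ℂ} (hζ : ‖ζ‖ = 1) (n : ℕ) {g : ℂ → ℂ} (hg : MemD μ g) (hlim : HasRadialLimitAt g ζ 0) :
    g ∈ closedSpan μ (fun z => (z - ζ) ^ n) := by
  refine ⟨hg, fun ε' hε' => ?_⟩
  obtain ⟨ε, hε, rfl⟩ : ∃ ε : ℝ, 0 < ε ∧ 30 * ε = ε' := ⟨ε' / 30, by positivity, by ring⟩
  let r : ℕ → ℝ := fun j => 1 - 1 / ((j : ℝ) + 2)
  have hr : ∀ j, r j ∈ Ioo (0 : ℝ) 1 := fun j => by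
    have hj : (0 : ℝ) ≤ j := j.cast_nonneg
    have h1 : 1 / ((j : ℝ) + 2) < 1 := by rw [div_lt_one (by linarith)]; linarith
    have h2 : 0 < 1 / ((j : ℝ) + 2) := by positivity
    exact ⟨by simp only [r]; linarith, by simp only [r]; linarith⟩
  have hr1 : Tendsto r atTop (𝓝 1) := by
    have h : Tendsto (fun j : ℕ => 1 / ((j : ℝ) + 2)) atTop (𝓝 0) := by
      have := tendsto_one_div_add_atTop_nhds_zero_nat (𝕜 := ℝ)
      refine squeeze_zero (fun j => by positivity) (fun j => ?_) this
      gcongr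
      norm_num
    simpa [r] using h.const_sub 1
  have hr2 : Tendsto r atTop (𝓝[<] 1) :=
    tendsto_nhdsWithin_iff.2 ⟨hr1, Eventually.of_forall fun j => (hr j).2⟩
  have hev1 := hr2.eventually (eventually_circleMeanSq_sub_dilate_le hg.1 hε)
  have hev2 := eventually_dirichletLInt_sub_dilate_lt hμ hg.1.1 ((memD_iff hμ).1 hg).2 hr hr1
    (show 0 < ENNReal.ofReal ε by simpa using hε)
  have hev3 : ∀ᶠ j in atTop, ‖g (r j * ζ)‖ ^ 2 < ε := by
    have := ((hlim.comp hr2).norm.pow 2)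
    simp only [norm_zero, ne_eq, OfNat.ofNat_ne_zero, not_false_eq_true, zero_pow] at this
    exact this.eventually (gt_mem_nhds hε)
  obtain ⟨j, ⟨h1, h2⟩, h3⟩ := ((hev1.and hev2).and hev3).exists
  obtain ⟨hj0, hj1⟩ := hr j
  generalize r j = s at *
  have hm1 := hg.sub hμ (memD_dilate hμ hg hj0 hj1)
  have hle1 : dNormSq μ (fun z => g z - g (s * z)) ≤ ε + ε := dNormSq_le_of hμ h1 hε.le h2.le
  have hcb : ∀ z ∈ disc, ‖(fun _ : ℂ => g (s * ζ)) z‖ ≤ ‖g (s * ζ)‖ := fun z _ => le_rfl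
  have hcd : ∀ z ∈ disc, ‖deriv (fun _ : ℂ => g (s * ζ)) z‖ ≤ 0 := fun z _ => by simp
  have hm2 : MemD μ (fun _ => g (s * ζ)) :=
    memD_of_deriv_bound hμ (differentiableOn_const _) hcb hcd
  have hle2 : dNormSq μ (fun _ => g (s * ζ)) ≤ ε := by
    have := dNormSq_le_of_deriv_bound hμ (differentiableOn_const _) hcb hcd
    refine this.trans ?_
    simpa using h3.le
  have hG : DifferentiableOn ℂ (fun z => g (s * z) - g (s * ζ)) (ball 0 s⁻¹) := by
    refine (hg.1.1.comp (by fun_prop) fun z hz => ?_).sub_const _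
    rw [mem_ball_zero_iff] at hz
    rw [mem_disc, norm_mul, Complex.norm_real, Real.norm_of_nonneg hj0.le]
    calc s * ‖z‖ < s * s⁻¹ := by gcongr
      _ = 1 := mul_inv_cancel₀ hj0.ne'
  obtain ⟨q, hm3, hle3⟩ := exists_polynomial_mul_pow_approx hμ hζ n ((one_lt_inv₀ hj0).2 hj1) hG
    (sub_self _) hε
  refine ⟨q, ?_⟩
  have e : (fun z => g z - q.eval z * (z - ζ) ^ n) = fun z => (g z - g (s * z)) +
      (g (s * ζ) + (g (s * z) - g (s * ζ) - q.eval z * (z - ζ) ^ n)) := by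
    ext z
    ring
  rw [e]
  have a1 := dNormSq_add_le hμ hm1 (hm2.add hμ hm3)
  have a2 := dNormSq_add_le hμ hm2 hm3
  linarith

lemma lintegral_disc_eq_average_rotate {h : ℂ → ℝ≥0∞} (hh : Measurable h) :
    ∫⁻ z in disc, h z = ∫⁻ z in disc, ∫⁻ t, h (bpt (-t) * z) ∂cm := by
  rw [lintegral_lintegral_swap]
  · simp [lintegral_disc_rotate]
  · have := continuous_bpt.measurable
    exact (hh.comp (by fun_prop : Measurable fun p : ℂ × ℝ => bpt (-p.2) * p.1)).aemeasurable

lemma inv_norm_sq_rotate_eq {ζ z : ℂ} (hζ : ‖ζ‖ = 1) (hz : ‖z‖ < 1) {R : ℝ} (hR : 1 < R) (t : ℝ) :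
    1 / ‖R * ζ - bpt (-t) * z‖ ^ 2 =
      1 / (R ^ 2 - ‖z‖ ^ 2) * pk ((starRingEnd ℂ) ζ * z / R) (bpt t) := by
  have hR0 : 0 < R := by linarith
  have hRc : (R : ℂ) ≠ 0 := by exact_mod_cast hR0.ne'
  have h1 : ‖bpt t - (starRingEnd ℂ) ζ * z / R‖ = ‖R * ζ - bpt (-t) * z‖ / R := by
    have h2 : ‖bpt t * (starRingEnd ℂ) ζ‖ = 1 := by simp [norm_bpt, hζ]
    have e1 : bpt t * bpt (-t) = 1 := by
      rw [bpt_neg, Complex.mul_conj, Complex.normSq_eq_norm_sq, norm_bpt]; simp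
    have e2 : ζ * (starRingEnd ℂ) ζ = 1 := by
      rw [Complex.mul_conj, Complex.normSq_eq_norm_sq, hζ]; simp
    have h3 : bpt t - (starRingEnd ℂ) ζ * z / R =
        (bpt t * (starRingEnd ℂ) ζ) * (R * ζ - bpt (-t) * z) / R := by
      field_simp
      linear_combination (-(bpt t * R)) * e2 + ((starRingEnd ℂ) ζ * z) * e1
    rw [h3, norm_div, norm_mul, h2, one_mul, Complex.norm_real, Real.norm_of_nonneg hR0.le]
  have h4 : ‖(starRingEnd ℂ) ζ * z / R‖ = ‖z‖ / R := by
    rw [norm_div, norm_mul, RCLike.norm_conj, hζ, one_mul, Complex.norm_real,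
      Real.norm_of_nonneg hR0.le]
  have h5 : R ^ 2 - ‖z‖ ^ 2 ≠ 0 := by nlinarith [norm_nonneg z]
  have h6 : ‖R * ζ - bpt (-t) * z‖ ≠ 0 := by
    have : R - ‖z‖ ≤ ‖R * ζ - bpt (-t) * z‖ := by
      have := norm_sub_norm_le (R * ζ) (bpt (-t) * z)
      rwa [norm_bpt_mul, norm_mul, hζ, mul_one, Complex.norm_real, Real.norm_of_nonneg hR0.le] at this
    linarith
  rw [pk, h1, h4]
  field_simp

lemma mul_pk_le_of_norm_eq_one {ζ l : ℂ} (hζ : ‖ζ‖ = 1) (hl : ‖l‖ = 1) {R ρ : ℝ} (hR : 1 < R)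
    (hρ0 : 0 ≤ ρ) (hρ : ρ < 1) :
    1 / (R ^ 2 - ρ ^ 2) * pk (ζ * (ρ ^ 2 / R : ℝ)) l ≤ 8 * (1 / ‖R * ζ - l‖ ^ 2) := by
  have hR0 : 0 < R := by linarith
  have hRc : (R : ℂ) ≠ 0 := by exact_mod_cast hR0.ne'
  have h1 : ‖l - ζ * (ρ ^ 2 / R : ℝ)‖ = ‖R * l - ρ ^ 2 * ζ‖ / R := by
    have : l - ζ * (ρ ^ 2 / R : ℝ) = (R * l - ρ ^ 2 * ζ) / R := by
      push_cast
      field_simp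
    rw [this, norm_div, Complex.norm_real, Real.norm_of_nonneg hR0.le]
  have h2 : ‖ζ * (ρ ^ 2 / R : ℝ)‖ = ρ ^ 2 / R := by
    rw [norm_mul, hζ, one_mul, Complex.norm_real, Real.norm_of_nonneg (by positivity)]
  have hsym : ‖R * l - ρ ^ 2 * ζ‖ ^ 2 = R ^ 2 + ρ ^ 4 - 2 * R * ρ ^ 2 * (l * (starRingEnd ℂ) ζ).re := by
    rw [Complex.sq_norm, Complex.normSq_sub, Complex.normSq_mul, Complex.normSq_mul]
    have : (R * l * (starRingEnd ℂ) (ρ ^ 2 * ζ)) = ((R * ρ ^ 2 : ℝ) : ℂ) * (l * (starRingEnd ℂ) ζ) := by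
      rw [map_mul, map_pow, Complex.conj_ofReal]
      push_cast
      ring
    rw [this, Complex.re_ofReal_mul]
    simp only [Complex.normSq_eq_norm_sq, hl, hζ, norm_pow, Complex.norm_real, Real.norm_eq_abs,
      sq_abs]
    ring
  have hsym' : ‖R * ζ - l‖ ^ 2 = R ^ 2 + 1 - 2 * R * (l * (starRingEnd ℂ) ζ).re := by
    have := norm_sub_rev (R * ζ) l
    rw [this, Complex.sq_norm, Complex.normSq_sub, Complex.normSq_mul]
    have : (l * (starRingEnd ℂ) (R * ζ)) = (R : ℂ) * (l * (starRingEnd ℂ) ζ) := by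
      rw [map_mul, Complex.conj_ofReal]
      ring
    rw [this, Complex.re_ofReal_mul]
    simp only [Complex.normSq_eq_norm_sq, hl, hζ, Complex.norm_real, Real.norm_eq_abs,
      sq_abs]
    ring
  set c := (l * (starRingEnd ℂ) ζ).re with hc
  have hc0 : |c| ≤ 1 := by
    refine (Complex.abs_re_le_norm (l * (starRingEnd ℂ) ζ)).trans_eq ?_
    rw [norm_mul, RCLike.norm_conj, hl, hζ, one_mul]
  obtain ⟨hc2, hc1⟩ := abs_le.1 hc0
  have hpos : 0 < R ^ 2 + 1 - 2 * R * c := by nlinarith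
  have hρ2 : ρ ^ 2 ≤ 1 := by nlinarith
  have hρ4 : ρ ^ 4 = (ρ ^ 2) ^ 2 := by ring
  have hpos' : 0 < R ^ 2 + ρ ^ 4 - 2 * R * ρ ^ 2 * c := by
    rw [hρ4]; nlinarith [mul_nonneg hR0.le (sq_nonneg ρ)]
  have hd : 0 < R ^ 2 - ρ ^ 2 := by nlinarith
  rw [pk, h1, h2, div_pow, div_pow, hsym, hsym', mul_one_div]
  have : 1 / (R ^ 2 - ρ ^ 2) * ((1 - (ρ ^ 2) ^ 2 / R ^ 2) / ((R ^ 2 + ρ ^ 4 - 2 * R * ρ ^ 2 * c) / R ^ 2)) =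
      (R ^ 2 - ρ ^ 4) / ((R ^ 2 - ρ ^ 2) * (R ^ 2 + ρ ^ 4 - 2 * R * ρ ^ 2 * c)) := by
    field_simp
  rw [this, div_le_div_iff₀ (by positivity) hpos]
  have k1 : R ^ 2 - ρ ^ 4 ≤ 2 * (R ^ 2 - ρ ^ 2) := by
    rw [hρ4]; nlinarith [mul_nonneg (sub_nonneg.2 hρ2) (sub_nonneg.2 hρ2)]
  have k2 : R ^ 2 + 1 - 2 * R * c ≤ 4 * (R ^ 2 + ρ ^ 4 - 2 * R * ρ ^ 2 * c) := by
    rw [hρ4]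
    have hx0 := sq_nonneg ρ
    set x := ρ ^ 2
    have p1 : 0 ≤ R ^ 2 + (2 * x - 1) ^ 2 - 2 * R * (2 * x - 1) * c := by
      nlinarith [sq_nonneg (R * c - (2 * x - 1)), mul_nonneg (sub_nonneg.2 hc1)
        (by linarith : (0:ℝ) ≤ 1 + c), sq_nonneg R]
    have p2 : (1 - x) ^ 2 ≤ R ^ 2 + x ^ 2 - 2 * R * x * c := by
      nlinarith [mul_nonneg (mul_nonneg hR0.le hx0) (sub_nonneg.2 hc1)]
    nlinarith
  calc _ ≤ (2 * (R ^ 2 - ρ ^ 2)) * (4 * (R ^ 2 + ρ ^ 4 - 2 * R * ρ ^ 2 * c)) := by gcongr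
    _ = _ := by ring

lemma lintegral_radial_mul_poissonLInt_le {μ : Measure ℂ} [IsFiniteMeasure μ] (hμ : OnCircle μ)
    {ζ : ℂ} (hζ : ‖ζ‖ = 1) {R : ℝ} (hR : 1 < R) {φ : ℝ → ℝ≥0∞} (hφ : Measurable φ) :
    ∫⁻ z in disc, φ ‖z‖ * (ENNReal.ofReal (1 / ‖R * ζ - z‖ ^ 2) * poissonLInt μ z) ≤
      ENNReal.ofReal 8 * (∫⁻ l, ENNReal.ofReal (1 / ‖R * ζ - l‖ ^ 2) ∂μ) *
        ∫⁻ z in disc, φ ‖z‖ := by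
  have hP := measurable_poissonLInt μ
  rw [lintegral_disc_eq_average_rotate (by fun_prop), ← lintegral_const_mul _ (by fun_prop)]
  refine setLIntegral_mono' measurableSet_disc fun z hz => ?_
  rw [mem_disc] at hz
  have hR0 : 0 < R := by linarith
  have hd : 0 < R ^ 2 - ‖z‖ ^ 2 := by nlinarith [norm_nonneg z]
  have hw : ‖(starRingEnd ℂ) ζ * z / R‖ < 1 := by
    rw [norm_div, norm_mul, RCLike.norm_conj, hζ, one_mul, Complex.norm_real,
      Real.norm_of_nonneg hR0.le, div_lt_one hR0]
    linarith
  simp only [inv_norm_sq_rotate_eq hζ hz hR, norm_bpt_mul,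
    ENNReal.ofReal_mul (one_div_nonneg.2 hd.le), mul_assoc (ENNReal.ofReal (1 / _))]
  have hm : Measurable fun t => poissonLInt μ (bpt (-t) * z) := by
    have := continuous_bpt.measurable
    exact hP.comp (by fun_prop)
  have hm' : Measurable fun t => ENNReal.ofReal (pk ((starRingEnd ℂ) ζ * z / R) (bpt t)) *
      poissonLInt μ (bpt (-t) * z) :=
    ((measurable_pk_bpt ((starRingEnd ℂ) ζ * z / R)).ennreal_ofReal).mul hm
  rw [lintegral_const_mul _ (hm'.const_mul _), lintegral_const_mul _ hm',
    lintegral_pk_mul_poissonLInt_rotate hμ hw hz, mul_comm (φ ‖z‖)]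
  refine mul_le_mul' ?_ le_rfl
  have he : (starRingEnd ℂ) ((starRingEnd ℂ) ζ * z / R) * z = ζ * (‖z‖ ^ 2 / R : ℝ) := by
    have : (starRingEnd ℂ) z * z = ((‖z‖ ^ 2 : ℝ) : ℂ) := by
      rw [← Complex.normSq_eq_norm_sq, Complex.normSq_eq_conj_mul_self]
    rw [map_div₀, map_mul, Complex.conj_conj, Complex.conj_ofReal, Complex.ofReal_div, ← this]
    ring
  rw [he, poissonLInt, ← lintegral_const_mul' _ _ ENNReal.ofReal_ne_top,
    ← lintegral_const_mul' _ _ ENNReal.ofReal_ne_top]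
  refine lintegral_mono_ae ?_
  filter_upwards [ae_norm_eq_one hμ] with l hl
  rw [bdryKernel_eq_pk hl, ← ENNReal.ofReal_mul (by positivity), ← ENNReal.ofReal_mul (by positivity)]
  exact ENNReal.ofReal_le_ofReal (mul_pk_le_of_norm_eq_one hζ hl hR (norm_nonneg z) hz)

lemma lintegral_disc_radial_le {φ : ℝ → ℝ≥0∞} (hφ : Measurable φ) :
    ∫⁻ z in disc, φ ‖z‖ ≤ ENNReal.ofReal (2 * Real.pi) * ∫⁻ x in Ioo (0:ℝ) 1, φ x := by
  rw [← lintegral_indicator measurableSet_disc, ← Complex.lintegral_comp_polarCoord_symm,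
    polarCoord_target, Measure.volume_eq_prod, ← Measure.prod_restrict,
    lintegral_prod_symm]
  · have : ∀ y : ℝ, ∫⁻ x in Ioi (0:ℝ), ENNReal.ofReal (x, y).1 •
        disc.indicator (fun z => φ ‖z‖) (Complex.polarCoord.symm (x, y)) ≤ ∫⁻ x in Ioo (0:ℝ) 1, φ x := by
      intro y
      rw [← lintegral_indicator measurableSet_Ioi, ← lintegral_indicator measurableSet_Ioo]
      refine lintegral_mono fun x => ?_
      by_cases hx : 0 < x
      · have hn : ‖Complex.polarCoord.symm (x, y)‖ = x := by
          rw [Complex.norm_polarCoord_symm, abs_of_pos hx]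
        by_cases hx1 : x < 1
        · rw [indicator_of_mem (mem_Ioi.2 hx), indicator_of_mem (mem_disc.2 (by rwa [hn])), hn,
            indicator_of_mem (mem_Ioo.2 ⟨hx, hx1⟩), smul_eq_mul]
          exact mul_le_of_le_one_left zero_le (ENNReal.ofReal_le_one.2 hx1.le)
        · rw [indicator_of_mem (mem_Ioi.2 hx), indicator_of_notMem (by rwa [mem_disc, hn])]
          simp
      · rw [indicator_of_notMem (by simpa using hx)]
        exact zero_le
    refine (lintegral_mono this).trans_eq ?_
    rw [lintegral_const, mul_comm]
    congr 1
    rw [Measure.restrict_apply_univ, Real.volume_Ioo]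
    ring_nf
  · refine Measurable.aemeasurable ?_
    refine (measurable_fst.ennreal_ofReal).mul ?_
    refine ((hφ.comp measurable_norm).indicator measurableSet_disc).comp ?_
    have : (Complex.polarCoord.symm : ℝ × ℝ → ℂ) =
        fun p => p.1 * (Real.cos p.2 + Real.sin p.2 * Complex.I) := by
      ext1 p
      exact Complex.polarCoord_symm_apply p
    rw [this]
    fun_prop

lemma lintegral_Ioo_inv_sqrt_mul_le {s : ℝ} (hs : 0 < s) :
    ∫⁻ x in Ioo (0:ℝ) 1, ENNReal.ofReal (1 / (Real.sqrt (1 - x) * (s + (1 - x)))) ≤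
      ENNReal.ofReal (Real.pi / Real.sqrt s) := by
  have hsq : 0 < Real.sqrt s := Real.sqrt_pos.2 hs
  let f : ℝ → ℝ := fun x => 2 / Real.sqrt s * Real.arctan (Real.sqrt (1 - x) / Real.sqrt s)
  let f' : ℝ → ℝ := fun x => -(1 / (Real.sqrt (1 - x) * (s + (1 - x))))
  have hd : ∀ x ∈ Ioo (0:ℝ) 1, HasDerivWithinAt f (f' x) (Ioo 0 1) x := by
    intro x hx
    have hx1 : 0 < 1 - x := by linarith [hx.2]
    have hq : 0 < Real.sqrt (1 - x) := Real.sqrt_pos.2 hx1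
    have h := ((((hasDerivAt_id x).const_sub 1).sqrt hx1.ne').div_const
      (Real.sqrt s)).arctan.const_mul (2 / Real.sqrt s)
    refine (h.congr_deriv ?_).hasDerivWithinAt
    simp only [f', id_eq, div_pow, Real.sq_sqrt hs.le, Real.sq_sqrt hx1.le]
    have : s + (1 - x) ≠ 0 := by positivity
    field_simp
    rw [Real.sq_sqrt hs.le]
  have hf : AntitoneOn f (Ioo 0 1) := by
    intro x _ y _ hxy
    simp only [f]
    gcongr
  have h := lintegral_deriv_eq_volume_image_of_antitoneOn measurableSet_Ioo hd hf
  simp only [f', neg_neg] at h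
  rw [h]
  have : f '' Ioo 0 1 ⊆ Icc 0 (Real.pi / Real.sqrt s) := by
    rintro _ ⟨x, _, rfl⟩
    have h1 : 0 ≤ Real.arctan (Real.sqrt (1 - x) / Real.sqrt s) :=
      Real.arctan_nonneg.2 (by positivity)
    have h2 := Real.arctan_lt_pi_div_two (Real.sqrt (1 - x) / Real.sqrt s)
    refine ⟨by positivity, ?_⟩
    simp only [f]
    rw [div_mul_eq_mul_div]
    gcongr
    linarith
  refine (measure_mono this).trans_eq ?_
  simp

lemma lintegral_disc_inv_sqrt_mul_le {s : ℝ} (hs : 0 < s) :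
    ∫⁻ z in disc, ENNReal.ofReal (1 / (Real.sqrt (1 - ‖z‖) * (s + (1 - ‖z‖)))) ≤
      ENNReal.ofReal (2 * Real.pi ^ 2 / Real.sqrt s) := by
  refine (lintegral_disc_radial_le
    (φ := fun x => ENNReal.ofReal (1 / (Real.sqrt (1 - x) * (s + (1 - x))))) (by fun_prop)).trans ?_
  refine (mul_le_mul' le_rfl (lintegral_Ioo_inv_sqrt_mul_le hs)).trans_eq ?_
  rw [← ENNReal.ofReal_mul (by positivity)]
  congr 1
  ring

/-- A combination of Cauchy kernels with poles at `(1 + 4⁻ᵏ) ζ`. -/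
def cauchySum (ζ : ℂ) (a : ℕ → ℝ) (N : ℕ) (z : ℂ) : ℂ :=
  ∑ k ∈ Finset.range N, (a k * (1 / 4) ^ k : ℝ) / (1 + (1 / 4) ^ k - (starRingEnd ℂ) ζ * z)

lemma norm_one_add_sub_conj_mul {ζ : ℂ} (hζ : ‖ζ‖ = 1) (k : ℕ) (z : ℂ) :
    ‖1 + (1 / 4 : ℂ) ^ k - (starRingEnd ℂ) ζ * z‖ = ‖((1 + (1 / 4) ^ k : ℝ) : ℂ) * ζ - z‖ := by
  have e2 : ζ * (starRingEnd ℂ) ζ = 1 := by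
    rw [Complex.mul_conj, Complex.normSq_eq_norm_sq, hζ]; simp
  have : 1 + (1 / 4 : ℂ) ^ k - (starRingEnd ℂ) ζ * z =
      (starRingEnd ℂ) ζ * (((1 + (1 / 4) ^ k : ℝ) : ℂ) * ζ - z) := by
    push_cast
    linear_combination (-(1 + (1 / 4 : ℂ) ^ k)) * e2
  rw [this, norm_mul, RCLike.norm_conj, hζ, one_mul]

lemma sub_norm_le_norm_mul_sub {ζ : ℂ} (hζ : ‖ζ‖ = 1) {R : ℝ} (hR : 0 ≤ R) (z : ℂ) :
    R - ‖z‖ ≤ ‖R * ζ - z‖ := by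
  have := norm_sub_norm_le (R * ζ) z
  rwa [norm_mul, hζ, mul_one, Complex.norm_real, Real.norm_of_nonneg hR] at this

lemma one_add_sub_conj_mul_ne_zero {ζ : ℂ} (hζ : ‖ζ‖ = 1) (k : ℕ) {z : ℂ} (hz : ‖z‖ ≤ 1) :
    1 + (1 / 4 : ℂ) ^ k - (starRingEnd ℂ) ζ * z ≠ 0 := by
  rw [← norm_pos_iff, norm_one_add_sub_conj_mul hζ]
  have := sub_norm_le_norm_mul_sub hζ (R := 1 + (1 / 4) ^ k) (by positivity) z
  have h2 : (0 : ℝ) < (1 / 4) ^ k := by positivity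
  linarith

lemma hasDerivAt_cauchySum {ζ : ℂ} (hζ : ‖ζ‖ = 1) (a : ℕ → ℝ) (N : ℕ) {z : ℂ} (hz : ‖z‖ ≤ 1) :
    HasDerivAt (cauchySum ζ a N) (∑ k ∈ Finset.range N, (a k * (1 / 4) ^ k : ℝ) *
      (starRingEnd ℂ) ζ / (1 + (1 / 4) ^ k - (starRingEnd ℂ) ζ * z) ^ 2) z := by
  unfold cauchySum
  refine HasDerivAt.fun_sum fun k _ => ?_
  have h := ((((hasDerivAt_id z).const_mul ((starRingEnd ℂ) ζ)).const_sub
    (1 + (1 / 4 : ℂ) ^ k)).inv (one_add_sub_conj_mul_ne_zero hζ k hz)).const_mul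
    ((a k * (1 / 4) ^ k : ℝ) : ℂ)
  refine (h.congr_deriv ?_)
  simp only [id_eq]
  ring

lemma norm_deriv_cauchySum_le {ζ : ℂ} (hζ : ‖ζ‖ = 1) {a : ℕ → ℝ} (ha : ∀ k, 0 ≤ a k) (N : ℕ) {z : ℂ}
    (hz : ‖z‖ ≤ 1) : ‖deriv (cauchySum ζ a N) z‖ ≤
      ∑ k ∈ Finset.range N, a k * (1 / 4) ^ k / ‖((1 + (1 / 4) ^ k : ℝ) : ℂ) * ζ - z‖ ^ 2 := by
  rw [(hasDerivAt_cauchySum hζ a N hz).deriv]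
  refine (norm_sum_le _ _).trans_eq (Finset.sum_congr rfl fun k _ => ?_)
  rw [norm_div, norm_mul, norm_pow, norm_one_add_sub_conj_mul hζ, RCLike.norm_conj, hζ, mul_one,
    Complex.norm_real, Real.norm_of_nonneg (mul_nonneg (ha k) (by positivity))]

lemma sum_half_pow_kernel_le {y : ℝ} (hy : 0 < y) (N : ℕ) :
    ∑ k ∈ Finset.range N, (1 / 2) ^ k * y / (((1 / 2) ^ k) ^ 2 + y ^ 2) ≤ 4 := by
  have key : ∀ σ : ℝ, 0 < σ → σ * y / (σ ^ 2 + y ^ 2) ≤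
      4 * (σ / (σ + y) - σ * (1 / 2) / (σ * (1 / 2) + y)) := by
    intro σ hσ
    have : σ / (σ + y) - σ * (1 / 2) / (σ * (1 / 2) + y) = σ * y / ((σ + y) * (σ + 2 * y)) := by
      field_simp
      ring
    rw [this, mul_div_assoc', div_le_div_iff₀ (by positivity) (by positivity)]
    have : (σ + y) * (σ + 2 * y) ≤ 4 * (σ ^ 2 + y ^ 2) := by nlinarith [sq_nonneg (σ - y)]
    nlinarith [mul_le_mul_of_nonneg_left this (mul_pos hσ hy).le]
  calc _ ≤ ∑ k ∈ Finset.range N, 4 * ((1 / 2) ^ k / ((1 / 2) ^ k + y) -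
        (1 / 2) ^ (k + 1) / ((1 / 2) ^ (k + 1) + y)) :=
        Finset.sum_le_sum fun k _ => key _ (by positivity)
    _ = 4 * (1 / (1 + y) - (1 / 2) ^ N / ((1 / 2) ^ N + y)) := by
        rw [← Finset.mul_sum,
          Finset.sum_range_sub' (fun k => ((1 / 2 : ℝ) ^ k / ((1 / 2) ^ k + y))), pow_zero]
    _ ≤ 4 := by
        have h1 : 1 / (1 + y) ≤ 1 := by rw [div_le_one (by positivity)]; linarith
        have h2 : 0 ≤ (1 / 2) ^ N / ((1 / 2) ^ N + y) := by positivity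
        linarith

lemma quarter_pow_eq (k : ℕ) : (1 / 4 : ℝ) ^ k = ((1 / 2) ^ k) ^ 2 := by
  rw [← pow_mul, mul_comm, pow_mul]
  norm_num

lemma norm_deriv_cauchySum_sq_le {ζ : ℂ} (hζ : ‖ζ‖ = 1) {a : ℕ → ℝ} (ha : ∀ k, 0 ≤ a k) (N : ℕ)
    {z : ℂ} (hz : ‖z‖ < 1) : ‖deriv (cauchySum ζ a N) z‖ ^ 2 ≤
      4 * ∑ k ∈ Finset.range N, (a k ^ 2 * ((1 / 2) ^ k) ^ 3) *
        ((1 / (Real.sqrt (1 - ‖z‖) * ((1 / 4) ^ k + (1 - ‖z‖)))) *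
          (1 / ‖((1 + (1 / 4) ^ k : ℝ) : ℂ) * ζ - z‖ ^ 2)) := by
  have hx : 0 < 1 - ‖z‖ := by linarith
  have hy := Real.sqrt_pos.2 hx
  have hd : ∀ k : ℕ, (1 / 4) ^ k + (1 - ‖z‖) ≤ ‖((1 + (1 / 4) ^ k : ℝ) : ℂ) * ζ - z‖ := by
    intro k
    have := sub_norm_le_norm_mul_sub hζ (R := 1 + (1 / 4) ^ k) (by positivity) z
    linarith
  have hcs := Finset.sum_sq_le_sum_mul_sum_of_sq_le_mul (Finset.range N)
    (r := fun k => a k * (1 / 4) ^ k / ‖((1 + (1 / 4) ^ k : ℝ) : ℂ) * ζ - z‖ ^ 2)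
    (f := fun k => (1 / 2) ^ k * Real.sqrt (1 - ‖z‖) / (((1 / 2) ^ k) ^ 2 + Real.sqrt (1 - ‖z‖) ^ 2))
    (g := fun k => (a k ^ 2 * ((1 / 2) ^ k) ^ 3) *
        ((1 / (Real.sqrt (1 - ‖z‖) * ((1 / 4) ^ k + (1 - ‖z‖)))) *
          (1 / ‖((1 + (1 / 4) ^ k : ℝ) : ℂ) * ζ - z‖ ^ 2)))
    (fun k _ => by positivity) (fun k _ => by positivity) (fun k _ => ?_)
  · refine (pow_le_pow_left₀ (norm_nonneg _) (norm_deriv_cauchySum_le hζ ha N hz.le) 2).trans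
      (hcs.trans ?_)
    exact mul_le_mul_of_nonneg_right (sum_half_pow_kernel_le hy N)
      (Finset.sum_nonneg fun k _ => by positivity)
  · have hdk := hd k
    rw [quarter_pow_eq] at hdk ⊢
    rw [Real.sq_sqrt hx.le]
    set d := ‖((1 + ((1 / 2) ^ k) ^ 2 : ℝ) : ℂ) * ζ - z‖
    set σ : ℝ := (1 / 2) ^ k
    have hσ : 0 < σ := by positivity
    set x := 1 - ‖z‖
    have hd0 : 0 < d := lt_of_lt_of_le (by positivity) hdk
    have e1 : (a k * σ ^ 2 / d ^ 2) ^ 2 = (a k ^ 2 * σ ^ 4) / (d ^ 2 * d ^ 2) := by ring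
    have e2 : σ * Real.sqrt x / (σ ^ 2 + x) * (a k ^ 2 * σ ^ 3 *
        (1 / (Real.sqrt x * (σ ^ 2 + x)) * (1 / d ^ 2))) =
        (a k ^ 2 * σ ^ 4) / ((σ ^ 2 + x) ^ 2 * d ^ 2) := by
      field_simp
    rw [e1, e2]
    gcongr

lemma dirichletLInt_cauchySum_le {μ : Measure ℂ} [IsFiniteMeasure μ] (hμ : OnCircle μ) {ζ : ℂ}
    (hζ : ‖ζ‖ = 1) {a : ℕ → ℝ} (ha : ∀ k, 0 ≤ a k) (N : ℕ) :
    dirichletLInt μ (cauchySum ζ a N) ≤ ENNReal.ofReal (64 * Real.pi ^ 2) *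
      ∑ k ∈ Finset.range N, ENNReal.ofReal (a k ^ 2 * (1 / 4) ^ k) *
        ∫⁻ l, ENNReal.ofReal (1 / ‖((1 + (1 / 4) ^ k : ℝ) : ℂ) * ζ - l‖ ^ 2) ∂μ := by
  have hP := measurable_poissonLInt μ
  let J : ℕ → ℂ → ℝ≥0∞ := fun k z =>
    ENNReal.ofReal (1 / (Real.sqrt (1 - ‖z‖) * ((1 / 4) ^ k + (1 - ‖z‖)))) *
      (ENNReal.ofReal (1 / ‖((1 + (1 / 4) ^ k : ℝ) : ℂ) * ζ - z‖ ^ 2) * poissonLInt μ z)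
  have hJ : ∀ k, Measurable (J k) := fun k => by
    simp only [J]
    fun_prop
  have h1 : ∀ z ∈ disc, ENNReal.ofReal (‖deriv (cauchySum ζ a N) z‖ ^ 2) * poissonLInt μ z ≤
      ENNReal.ofReal 4 * ∑ k ∈ Finset.range N, ENNReal.ofReal (a k ^ 2 * ((1 / 2) ^ k) ^ 3) * J k z := by
    intro z hz
    have hz' := mem_disc.1 hz
    have hx : 0 < 1 - ‖z‖ := by linarith
    refine (mul_le_mul' (ENNReal.ofReal_le_ofReal (norm_deriv_cauchySum_sq_le hζ ha N hz'))
      le_rfl).trans_eq ?_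
    rw [ENNReal.ofReal_mul (by norm_num), ENNReal.ofReal_sum_of_nonneg (fun k _ => by positivity),
      mul_assoc, Finset.sum_mul]
    congr 1
    refine Finset.sum_congr rfl fun k _ => ?_
    rw [ENNReal.ofReal_mul (mul_nonneg (sq_nonneg _) (by positivity)),
      ENNReal.ofReal_mul (p := 1 / (_ * _)) (by positivity)]
    simp only [J, mul_assoc]
  have h2 : ∀ k, ENNReal.ofReal (a k ^ 2 * ((1 / 2) ^ k) ^ 3) * ∫⁻ z in disc, J k z ≤
      ENNReal.ofReal (16 * Real.pi ^ 2) * (ENNReal.ofReal (a k ^ 2 * (1 / 4) ^ k) *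
        ∫⁻ l, ENNReal.ofReal (1 / ‖((1 + (1 / 4) ^ k : ℝ) : ℂ) * ζ - l‖ ^ 2) ∂μ) := by
    intro k
    have hs : (0:ℝ) < (1 / 4) ^ k := by positivity
    have hE := lintegral_radial_mul_poissonLInt_le hμ hζ (R := 1 + (1 / 4) ^ k) (by linarith)
      (φ := fun x => ENNReal.ofReal (1 / (Real.sqrt (1 - x) * ((1 / 4) ^ k + (1 - x))))) (by fun_prop)
    have hE' := hE.trans (mul_le_mul' le_rfl (lintegral_disc_inv_sqrt_mul_le hs))
    refine (mul_le_mul' le_rfl hE').trans_eq ?_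
    have : ENNReal.ofReal (16 * Real.pi ^ 2) * ENNReal.ofReal (a k ^ 2 * (1 / 4) ^ k) =
        ENNReal.ofReal (a k ^ 2 * ((1 / 2) ^ k) ^ 3) * ENNReal.ofReal 8 *
          ENNReal.ofReal (2 * Real.pi ^ 2 / Real.sqrt ((1 / 4) ^ k)) := by
      rw [← ENNReal.ofReal_mul (by positivity), ← ENNReal.ofReal_mul (by positivity),
        ← ENNReal.ofReal_mul (by positivity), quarter_pow_eq, Real.sqrt_sq (by positivity)]
      congr 1
      field_simp
      ring
    rw [← mul_assoc (ENNReal.ofReal (16 * Real.pi ^ 2)), this]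
    ring
  calc dirichletLInt μ (cauchySum ζ a N)
      ≤ ∫⁻ z in disc, ENNReal.ofReal 4 *
          ∑ k ∈ Finset.range N, ENNReal.ofReal (a k ^ 2 * ((1 / 2) ^ k) ^ 3) * J k z :=
        setLIntegral_mono' measurableSet_disc h1
    _ = ENNReal.ofReal 4 * ∑ k ∈ Finset.range N,
          ENNReal.ofReal (a k ^ 2 * ((1 / 2) ^ k) ^ 3) * ∫⁻ z in disc, J k z := by
        rw [lintegral_const_mul' _ _ ENNReal.ofReal_ne_top,
          lintegral_finsetSum _ fun k _ => (hJ k).const_mul _]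
        congr 1
        exact Finset.sum_congr rfl fun k _ => lintegral_const_mul _ (hJ k)
    _ ≤ ENNReal.ofReal 4 * ∑ k ∈ Finset.range N, ENNReal.ofReal (16 * Real.pi ^ 2) *
          (ENNReal.ofReal (a k ^ 2 * (1 / 4) ^ k) *
            ∫⁻ l, ENNReal.ofReal (1 / ‖((1 + (1 / 4) ^ k : ℝ) : ℂ) * ζ - l‖ ^ 2) ∂μ) :=
        mul_le_mul' le_rfl (Finset.sum_le_sum fun k _ => h2 k)
    _ = _ := by
        rw [← Finset.mul_sum, ← mul_assoc, ← ENNReal.ofReal_mul (by norm_num)]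
        congr 2
        ring

lemma poissonExt_eq_integral_cm (u : ℝ → ℝ) (z : ℂ) :
    poissonExt u z = ∫ t, pk z (bpt t) * u t ∂cm := by
  rw [integral_cm]; rfl

lemma norm_fderiv_poissonExt_le {G : ℂ → ℂ} (hG : DiffContOnCl ℂ G (ball 0 1)) {z : ℂ}
    (hz : ‖z‖ < 1) :
    ‖fderiv ℝ (poissonExt fun t => (G (bpt t)).re) z‖ ≤ ‖deriv G z‖ := by
  have hzm : z ∈ ball (0:ℂ) 1 := by simpa using hz
  have he : poissonExt (fun t => (G (bpt t)).re) =ᶠ[𝓝 z] fun w => (G w).re := by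
    filter_upwards [isOpen_ball.mem_nhds hzm] with w hw
    rw [poissonExt_eq_integral_cm, poisson_formula_re hG (by simpa using hw)]
  have hd : HasDerivAt G (deriv G z) z :=
    (hG.differentiableOn.differentiableAt (isOpen_ball.mem_nhds hzm)).hasDerivAt
  have hf := Complex.reCLM.hasFDerivAt.comp z (hd.hasFDerivAt.restrictScalars ℝ)
  rw [he.fderiv_eq, HasFDerivAt.fderiv (f := fun w => (G w).re) hf]
  refine ContinuousLinearMap.opNorm_le_bound _ (norm_nonneg _) fun v => ?_
  simp only [ContinuousLinearMap.comp_apply, ContinuousLinearMap.coe_restrictScalars',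
    ContinuousLinearMap.toSpanSingleton_apply, Complex.reCLM_apply, Real.norm_eq_abs]
  refine (Complex.abs_re_le_norm _).trans_eq ?_
  rw [smul_eq_mul, norm_mul, mul_comm]

lemma memDh_re_bpt {μ : Measure ℂ} [IsFiniteMeasure μ] (hμ : OnCircle μ) {G : ℂ → ℂ}
    (hG : DiffContOnCl ℂ G (ball 0 1)) (hD : dirichletLInt μ G ≠ ⊤) :
    MemDh μ (fun t => (G (bpt t)).re) ∧
      dhNormSq μ (fun t => (G (bpt t)).re) ≤
        ∫ t, ‖G (bpt t)‖ ^ 2 ∂cm + dirichletIntegral μ G := by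
  have hGc := continuous_comp_bpt hG
  have hre : Continuous fun t => (G (bpt t)).re := Complex.continuous_re.comp hGc
  have hgrad := (integrableOn_dirichletDensity_iff hμ G).2 hD
  have hle : ∀ z ∈ disc, gradDensity μ (fun t => (G (bpt t)).re) z ≤ dirichletDensity μ G z := by
    intro z hz
    have := norm_fderiv_poissonExt_le hG (mem_disc.1 hz)
    exact mul_le_mul_of_nonneg_right (pow_le_pow_left₀ (norm_nonneg _) this 2)
      (poissonMu_nonneg μ (mem_disc.1 hz))
  have hgi : IntegrableOn (gradDensity μ (fun t => (G (bpt t)).re)) disc := by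
    refine Integrable.mono' hgrad ?_ ?_
    · exact (((measurable_fderiv ℝ _).norm.pow_const 2).stronglyMeasurable.mul
        (stronglyMeasurable_poissonMu μ)).aestronglyMeasurable
    · filter_upwards [ae_restrict_mem measurableSet_disc] with z hz
      rw [Real.norm_of_nonneg]
      · exact hle z hz
      · exact mul_nonneg (by positivity) (poissonMu_nonneg μ (mem_disc.1 hz))
  refine ⟨⟨?_, hgi⟩, ?_⟩
  · exact ((hre.pow 2).integrableOn_Icc).mono_set Ioc_subset_Icc_self
  · refine add_le_add ?_ ?_
    · rw [← intervalIntegral.integral_of_le (by positivity)]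
      have := integral_cm fun t => (G (bpt t)).re ^ 2
      rw [smul_eq_mul] at this
      rw [← this]
      refine integral_mono (integrable_cm (hre.pow 2)) (integrable_cm (hGc.norm.pow 2)) fun t => ?_
      simp only
      rw [← sq_abs]
      exact pow_le_pow_left₀ (abs_nonneg _) (Complex.abs_re_le_norm _) 2
    · refine mul_le_mul_of_nonneg_left ?_ (by positivity)
      exact setIntegral_mono_on hgi hgrad measurableSet_disc hle

lemma diffContOnCl_cauchySum {ζ : ℂ} (hζ : ‖ζ‖ = 1) (a : ℕ → ℝ) (N : ℕ) :
    DiffContOnCl ℂ (cauchySum ζ a N) (ball 0 1) := by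
  apply DifferentiableOn.diffContOnCl
  rw [closure_ball _ one_ne_zero]
  intro x hx
  exact (hasDerivAt_cauchySum hζ a N (by simpa using hx)).differentiableAt.differentiableWithinAt

lemma integral_inv_norm_sq_bpt {ζ : ℂ} (hζ : ‖ζ‖ = 1) {R : ℝ} (hR : 1 < R) :
    ∫ t, 1 / ‖R * ζ - bpt t‖ ^ 2 ∂cm = 1 / (R ^ 2 - 1) := by
  have hR0 : 0 < R := by linarith
  have hRc : (R : ℂ) ≠ 0 := by exact_mod_cast hR0.ne'
  have h4 : ‖ζ / R‖ = 1 / R := by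
    rw [norm_div, hζ, Complex.norm_real, Real.norm_of_nonneg hR0.le]
  have hw : ‖ζ / R‖ < 1 := by rw [h4, div_lt_one hR0]; exact hR
  have h5 : R ^ 2 - 1 ≠ 0 := by nlinarith
  suffices h : ∀ t, 1 / ‖R * ζ - bpt t‖ ^ 2 = 1 / (R ^ 2 - 1) * pk (ζ / R) (bpt t) by
    simp only [h]
    rw [integral_const_mul, integral_pk hw, mul_one]
  intro t
  have hsym : ‖R * ζ - bpt t‖ = ‖R * bpt t - ζ‖ := by
    rw [← sq_eq_sq₀ (norm_nonneg _) (norm_nonneg _), Complex.sq_norm, Complex.sq_norm,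
      Complex.normSq_sub, Complex.normSq_sub, Complex.normSq_mul, Complex.normSq_mul]
    simp only [Complex.normSq_eq_norm_sq, hζ, norm_bpt]
    simp
    ring
  have h1 : bpt t - ζ / R = (R * bpt t - ζ) / R := by field_simp
  have h6 : ‖R * bpt t - ζ‖ ≠ 0 := by
    have := norm_sub_norm_le (R * bpt t) ζ
    rw [norm_mul, norm_bpt, hζ, mul_one, Complex.norm_real, Real.norm_of_nonneg hR0.le] at this
    linarith
  rw [pk, h4, h1, norm_div, Complex.norm_real, Real.norm_of_nonneg hR0.le, hsym]
  field_simp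

lemma norm_cauchySum_sq_le {ζ : ℂ} (hζ : ‖ζ‖ = 1) {a : ℕ → ℝ} (ha : ∀ k, 0 ≤ a k) (N : ℕ) (z : ℂ) :
    ‖cauchySum ζ a N z‖ ^ 2 ≤
      2 * ∑ k ∈ Finset.range N, (a k ^ 2 * ((1 / 2) ^ k) ^ 3) *
        (1 / ‖((1 + (1 / 4) ^ k : ℝ) : ℂ) * ζ - z‖ ^ 2) := by
  have h1 : ‖cauchySum ζ a N z‖ ≤
      ∑ k ∈ Finset.range N, a k * (1 / 4) ^ k / ‖((1 + (1 / 4) ^ k : ℝ) : ℂ) * ζ - z‖ := by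
    refine (norm_sum_le _ _).trans_eq (Finset.sum_congr rfl fun k _ => ?_)
    rw [norm_div, norm_one_add_sub_conj_mul hζ, Complex.norm_real,
      Real.norm_of_nonneg (mul_nonneg (ha k) (by positivity))]
  have hcs := Finset.sum_sq_le_sum_mul_sum_of_sq_le_mul (Finset.range N)
    (r := fun k => a k * (1 / 4) ^ k / ‖((1 + (1 / 4) ^ k : ℝ) : ℂ) * ζ - z‖)
    (f := fun k => (1 / 2) ^ k)
    (g := fun k => (a k ^ 2 * ((1 / 2) ^ k) ^ 3) *
        (1 / ‖((1 + (1 / 4) ^ k : ℝ) : ℂ) * ζ - z‖ ^ 2))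
    (fun k _ => by positivity) (fun k _ => by positivity) (fun k _ => le_of_eq (by
      rw [quarter_pow_eq]
      ring))
  refine (pow_le_pow_left₀ (norm_nonneg _) h1 2).trans (hcs.trans ?_)
  refine mul_le_mul_of_nonneg_right ?_ (Finset.sum_nonneg fun k _ => by positivity)
  have := geom_sum_eq (x := (1 / 2 : ℝ)) (by norm_num) N
  rw [this]
  have : (0:ℝ) < (1 / 2) ^ N := by positivity
  rw [div_le_iff_of_neg (by norm_num)]
  linarith

lemma continuous_inv_norm_sq_bpt {ζ : ℂ} (hζ : ‖ζ‖ = 1) {R : ℝ} (hR : 1 < R) :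
    Continuous fun t => 1 / ‖R * ζ - bpt t‖ ^ 2 := by
  refine continuous_const.div ((continuous_const.sub continuous_bpt).norm.pow 2) fun t => ?_
  have := sub_norm_le_norm_mul_sub hζ (R := R) (by linarith) (bpt t)
  rw [norm_bpt] at this
  have : 0 < ‖R * ζ - bpt t‖ := by linarith
  positivity

lemma integral_norm_cauchySum_sq_le {ζ : ℂ} (hζ : ‖ζ‖ = 1) {a : ℕ → ℝ} (ha : ∀ k, 0 ≤ a k) (N : ℕ) :
    ∫ t, ‖cauchySum ζ a N (bpt t)‖ ^ 2 ∂cm ≤ ∑ k ∈ Finset.range N, a k ^ 2 * (1 / 2) ^ k := by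
  have hR : ∀ k : ℕ, 1 < 1 + (1 / 4 : ℝ) ^ k := fun k => by
    have : (0 : ℝ) < (1 / 4) ^ k := by positivity
    linarith
  have hi : ∀ k : ℕ, Integrable (fun t => (a k ^ 2 * ((1 / 2) ^ k) ^ 3) *
        (1 / ‖((1 + (1 / 4) ^ k : ℝ) : ℂ) * ζ - bpt t‖ ^ 2)) cm := fun k =>
    (integrable_cm (continuous_inv_norm_sq_bpt hζ (hR k))).const_mul _
  have h := integral_mono (integrable_cm
    ((continuous_comp_bpt (diffContOnCl_cauchySum hζ a N)).norm.pow 2))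
    ((integrable_finsetSum (Finset.range N) fun k _ => hi k).const_mul 2)
    (fun t => norm_cauchySum_sq_le hζ ha N (bpt t))
  refine h.trans ?_
  rw [integral_const_mul, integral_finsetSum _ fun k _ => hi k, Finset.mul_sum]
  refine Finset.sum_le_sum fun k _ => ?_
  rw [integral_const_mul, integral_inv_norm_sq_bpt hζ (hR k)]
  have hs : (0 : ℝ) < (1 / 2) ^ k := by positivity
  have h1 : 1 / ((1 + (1 / 4 : ℝ) ^ k) ^ 2 - 1) ≤ 1 / (2 * ((1 / 2) ^ k) ^ 2) := by
    rw [quarter_pow_eq]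
    refine one_div_le_one_div_of_le (by positivity) ?_
    nlinarith [sq_nonneg (((1 / 2 : ℝ) ^ k) ^ 2)]
  calc _ ≤ 2 * (a k ^ 2 * ((1 / 2) ^ k) ^ 3 * (1 / (2 * ((1 / 2) ^ k) ^ 2))) := by gcongr
    _ = _ := by
      field_simp

/-- The weight `4⁻ᵏ ∫ |(1 + 4⁻ᵏ) ζ - λ|⁻² dμ(λ)`, comparable to the Poisson integral of `μ` near
`(1 - 4⁻ᵏ) ζ`. -/
def poleWeight (μ : Measure ℂ) (ζ : ℂ) (k : ℕ) : ℝ :=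
  (1 / 4) ^ k * ∫ l, 1 / ‖((1 + (1 / 4) ^ k : ℝ) : ℂ) * ζ - l‖ ^ 2 ∂μ

lemma integrable_inv_norm_sq {μ : Measure ℂ} [IsFiniteMeasure μ] (hμ : OnCircle μ) {ζ : ℂ}
    (hζ : ‖ζ‖ = 1) {R : ℝ} (hR : 1 < R) : Integrable (fun l => 1 / ‖R * ζ - l‖ ^ 2) μ := by
  refine Integrable.of_bound (C := 1 / (R - 1) ^ 2)
    (Measurable.aestronglyMeasurable (by fun_prop)) ?_
  filter_upwards [ae_norm_eq_one hμ] with l hl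
  have h := sub_norm_le_norm_mul_sub hζ (R := R) (by linarith) l
  rw [hl] at h
  have : 0 < R - 1 := by linarith
  rw [Real.norm_of_nonneg (by positivity)]
  gcongr

lemma poleWeight_nonneg (μ : Measure ℂ) (ζ : ℂ) (k : ℕ) : 0 ≤ poleWeight μ ζ k :=
  mul_nonneg (by positivity) (integral_nonneg fun l => by positivity)

lemma ofReal_mul_lintegral_inv_norm_sq {μ : Measure ℂ} [IsFiniteMeasure μ] (hμ : OnCircle μ) {ζ : ℂ}
    (hζ : ‖ζ‖ = 1) (k : ℕ) {c : ℝ} (hc : 0 ≤ c) :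
    ENNReal.ofReal (c * (1 / 4) ^ k) *
        ∫⁻ l, ENNReal.ofReal (1 / ‖((1 + (1 / 4) ^ k : ℝ) : ℂ) * ζ - l‖ ^ 2) ∂μ =
      ENNReal.ofReal (c * poleWeight μ ζ k) := by
  have hR : 1 < 1 + (1 / 4 : ℝ) ^ k := by
    have : (0 : ℝ) < (1 / 4) ^ k := by positivity
    linarith
  rw [← ofReal_integral_eq_lintegral_ofReal (integrable_inv_norm_sq hμ hζ hR)
    (ae_of_all _ fun l => by positivity), ← ENNReal.ofReal_mul (by positivity), poleWeight, mul_assoc]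

lemma re_cauchySum_bpt (ζ : ℂ) (a : ℕ → ℝ) (N : ℕ) (z : ℂ) :
    (cauchySum ζ a N z).re = ∑ k ∈ Finset.range N,
      a k * ((1 / 4) ^ k / (1 + (1 / 4) ^ k - (starRingEnd ℂ) ζ * z)).re := by
  rw [cauchySum, Complex.re_sum]
  refine Finset.sum_congr rfl fun k _ => ?_
  rw [← Complex.re_ofReal_mul]
  congr 1
  push_cast
  ring

lemma re_one_sub_conj_mul_nonneg {ζ l : ℂ} (hζ : ‖ζ‖ = 1) (hl : ‖l‖ = 1) :
    0 ≤ (1 - (starRingEnd ℂ) ζ * l).re := by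
  have := Complex.re_le_norm ((starRingEnd ℂ) ζ * l)
  rw [norm_mul, RCLike.norm_conj, hζ, hl] at this
  simp only [Complex.sub_re, Complex.one_re]
  linarith

lemma re_div_add_eq (s : ℝ) (v : ℂ) :
    ((s : ℂ) / (s + v)).re = s * (s + v.re) / ‖(s : ℂ) + v‖ ^ 2 := by
  rw [Complex.div_re, Complex.sq_norm]
  simp

lemma re_div_add_nonneg {s : ℝ} (hs : 0 ≤ s) {v : ℂ} (hv : 0 ≤ v.re) :
    0 ≤ ((s : ℂ) / (s + v)).re := by
  rw [re_div_add_eq]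
  positivity

lemma quarter_le_re_div_add {s : ℝ} (hs : 0 < s) {v : ℂ} (hv : 0 ≤ v.re) (hvs : ‖v‖ ≤ s) :
    1 / 4 ≤ ((s : ℂ) / (s + v)).re := by
  rw [re_div_add_eq]
  have h1 : ‖(s : ℂ) + v‖ ≤ 2 * s := by
    refine (norm_add_le _ _).trans ?_
    rw [Complex.norm_real, Real.norm_of_nonneg hs.le]
    linarith
  have h2 : s ≤ ‖(s : ℂ) + v‖ := by
    refine le_trans ?_ (Complex.re_le_norm _)
    simpa using hv
  have h3 : 0 < ‖(s : ℂ) + v‖ := by linarith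
  rw [div_le_div_iff₀ (by norm_num) (by positivity)]
  nlinarith [mul_nonneg hs.le hv]

lemma cap_singleton_le_of_four_le_sum {μ : Measure ℂ} [IsFiniteMeasure μ] (hμ : OnCircle μ) {ζ : ℂ}
    (hζ : ‖ζ‖ = 1) {a : ℕ → ℝ} (ha : ∀ k, 0 ≤ a k) {N : ℕ} (hN : 4 ≤ ∑ k ∈ Finset.range N, a k) :
    cap μ {ζ} ≤ ENNReal.ofReal (∑ k ∈ Finset.range N, a k ^ 2 * (1 / 2) ^ k +
      64 * Real.pi * ∑ k ∈ Finset.range N, a k ^ 2 * poleWeight μ ζ k) := by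
  have hD : dirichletLInt μ (cauchySum ζ a N) ≤
      ENNReal.ofReal (64 * Real.pi ^ 2 * ∑ k ∈ Finset.range N, a k ^ 2 * poleWeight μ ζ k) := by
    refine (dirichletLInt_cauchySum_le hμ hζ ha N).trans_eq ?_
    rw [ENNReal.ofReal_mul (p := 64 * Real.pi ^ 2) (by positivity), ENNReal.ofReal_sum_of_nonneg
      (fun k _ => mul_nonneg (sq_nonneg _) (poleWeight_nonneg μ ζ k))]
    congr 1
    exact Finset.sum_congr rfl fun k _ => ofReal_mul_lintegral_inv_norm_sq hμ hζ k (sq_nonneg _)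
  have hD' := hD.trans_lt ENNReal.ofReal_lt_top
  obtain ⟨hmem, hnorm⟩ := memDh_re_bpt hμ (diffContOnCl_cauchySum hζ a N) hD'.ne
  have hs : ∀ k : ℕ, (0 : ℝ) < (1 / 4) ^ k := fun k => by positivity
  have hterm : ∀ (k : ℕ) (z : ℂ), (1 / 4 : ℂ) ^ k / (1 + (1 / 4) ^ k - (starRingEnd ℂ) ζ * z) =
      (((1 / 4 : ℝ) ^ k : ℝ) : ℂ) / ((((1 / 4 : ℝ) ^ k : ℝ) : ℂ) + (1 - (starRingEnd ℂ) ζ * z)) := by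
    intro k z
    push_cast
    congr 1
    ring
  have hnonneg : ∀ t, 0 ≤ (cauchySum ζ a N (bpt t)).re := by
    intro t
    rw [re_cauchySum_bpt]
    refine Finset.sum_nonneg fun k _ => mul_nonneg (ha k) ?_
    rw [hterm]
    exact re_div_add_nonneg (hs k).le (re_one_sub_conj_mul_nonneg hζ (norm_bpt t))
  have hone : ∀ t, bpt t ∈ ball ζ ((1 / 4) ^ N) ∩ circleT → 1 ≤ (cauchySum ζ a N (bpt t)).re := by
    intro t ht
    rw [re_cauchySum_bpt]
    have h : ∑ k ∈ Finset.range N, a k * (1 / 4) ≤ ∑ k ∈ Finset.range N,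
        a k * ((1 / 4) ^ k / (1 + (1 / 4) ^ k - (starRingEnd ℂ) ζ * bpt t)).re := by
      refine Finset.sum_le_sum fun k hk => mul_le_mul_of_nonneg_left ?_ (ha k)
      rw [hterm]
      refine quarter_le_re_div_add (hs k) (re_one_sub_conj_mul_nonneg hζ (norm_bpt t)) ?_
      rw [norm_one_sub_conj_mul hζ, ← dist_eq_norm, dist_comm]
      exact (mem_ball.1 ht.1).le.trans
        (pow_le_pow_of_le_one (by norm_num) (by norm_num) (Finset.mem_range.1 hk).le)
    rw [← Finset.sum_mul] at h
    linarith
  have hU : RelOpen (ball ζ ((1 / 4) ^ N) ∩ circleT) ∧ {ζ} ⊆ ball ζ ((1 / 4) ^ N) ∩ circleT :=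
    ⟨⟨_, isOpen_ball, rfl⟩, singleton_subset_iff.2
      ⟨mem_ball_self (hs N), by simpa [circleT] using hζ⟩⟩
  refine iInf₂_le_of_le _ hU (iInf₂_le_of_le (fun t => (cauchySum ζ a N (bpt t)).re)
    ⟨hmem, hnonneg, ae_of_all _ hone⟩ ?_)
  refine ENNReal.ofReal_le_ofReal (hnorm.trans (add_le_add
    (integral_norm_cauchySum_sq_le hζ ha N) ?_))
  have hsum : 0 ≤ ∑ k ∈ Finset.range N, a k ^ 2 * poleWeight μ ζ k :=
    Finset.sum_nonneg fun k _ => mul_nonneg (sq_nonneg _) (poleWeight_nonneg μ ζ k)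
  rw [dirichletIntegral_eq hμ]
  have := ENNReal.toReal_le_of_le_ofReal (by positivity) hD
  calc _ ≤ 1 / Real.pi * (64 * Real.pi ^ 2 * ∑ k ∈ Finset.range N, a k ^ 2 * poleWeight μ ζ k) := by
        gcongr
    _ = _ := by field_simp

lemma summable_inv_of_cap_pos {μ : Measure ℂ} [IsFiniteMeasure μ] (hμ : OnCircle μ) {ζ : ℂ}
    (hζ : ‖ζ‖ = 1) (hcap : 0 < cap μ {ζ}) :
    Summable fun k => 1 / (poleWeight μ ζ k + (1 / 2) ^ k) := by
  have hw := poleWeight_nonneg μ ζ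
  have hb : ∀ k : ℕ, 0 < poleWeight μ ζ k + (1 / 2) ^ k := fun k =>
    add_pos_of_nonneg_of_pos (hw k) (by positivity)
  by_contra hns
  rw [not_summable_iff_tendsto_nat_atTop_of_nonneg (fun k => (one_div_pos.2 (hb k)).le)] at hns
  refine hcap.ne' (le_antisymm (ge_of_tendsto' (x := atTop)
    (f := fun N : ℕ => ENNReal.ofReal ((16 + 1024 * Real.pi) /
      (∑ k ∈ Finset.range (N + 1), 1 / (poleWeight μ ζ k + (1 / 2) ^ k)))) ?_ ?_) zero_le)
  · rw [← ENNReal.ofReal_zero]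
    exact ENNReal.tendsto_ofReal
      (tendsto_const_nhds.div_atTop (hns.comp (tendsto_add_atTop_nat 1)))
  · intro N
    set A := ∑ k ∈ Finset.range (N + 1), 1 / (poleWeight μ ζ k + (1 / 2) ^ k) with hA
    have hApos : 0 < A := Finset.sum_pos (fun k _ => one_div_pos.2 (hb k)) (by simp)
    refine (cap_singleton_le_of_four_le_sum hμ hζ (N := N + 1)
      (a := fun k => 4 / A * (1 / (poleWeight μ ζ k + (1 / 2) ^ k)))
      (fun k => mul_nonneg (by positivity) (one_div_pos.2 (hb k)).le) ?_).trans
      (ENNReal.ofReal_le_ofReal ?_)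
    · rw [← Finset.mul_sum, ← hA]
      field_simp
      rfl
    · have key : ∀ c : ℕ → ℝ, (∀ k, 0 ≤ c k) → (∀ k, c k ≤ poleWeight μ ζ k + (1 / 2) ^ k) →
          ∑ k ∈ Finset.range (N + 1), (4 / A * (1 / (poleWeight μ ζ k + (1 / 2) ^ k))) ^ 2 * c k ≤
            16 / A := by
        intro c hc0 hc
        have h1 : ∀ k, (4 / A * (1 / (poleWeight μ ζ k + (1 / 2) ^ k))) ^ 2 * c k ≤
            16 / A ^ 2 * (1 / (poleWeight μ ζ k + (1 / 2) ^ k)) := by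
          intro k
          have := hb k
          calc _ ≤ (4 / A * (1 / (poleWeight μ ζ k + (1 / 2) ^ k))) ^ 2 *
                (poleWeight μ ζ k + (1 / 2) ^ k) := by gcongr; exact hc k
            _ = _ := by field_simp; norm_num
        refine (Finset.sum_le_sum fun k _ => h1 k).trans_eq ?_
        rw [← Finset.mul_sum, ← hA]
        field_simp
      have k1 := key (fun k => (1 / 2) ^ k) (fun k => by positivity)
        (fun k => le_add_of_nonneg_left (hw k))
      have k2 := key (poleWeight μ ζ) hw (fun k => le_add_of_nonneg_right (by positivity))
      calc _ ≤ 16 / A + 64 * Real.pi * (16 / A) := by gcongr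
        _ = _ := by ring

lemma exists_summable_inv_poleWeight {μ : Measure ℂ} [IsFiniteMeasure μ] (hμ : OnCircle μ) {ζ : ℂ}
    (hζ : ‖ζ‖ = 1) (hcap : 0 < cap μ {ζ}) :
    (∀ k, 0 < poleWeight μ ζ k) ∧ Summable fun k => 1 / poleWeight μ ζ k := by
  have hS := summable_inv_of_cap_pos hμ hζ hcap
  have hw := poleWeight_nonneg μ ζ
  have hb : ∀ k : ℕ, 0 < poleWeight μ ζ k + (1 / 2) ^ k := fun k =>
    add_pos_of_nonneg_of_pos (hw k) (by positivity)
  have hev : ∀ᶠ k in atTop, 1 ≤ poleWeight μ ζ k := by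
    filter_upwards [hS.tendsto_atTop_zero.eventually (gt_mem_nhds (by norm_num : (0:ℝ) < 1 / 2))]
      with k hk
    have h1 : (1 / 2 : ℝ) ^ k ≤ 1 := pow_le_one₀ (by norm_num) (by norm_num)
    rw [div_lt_div_iff₀ (hb k) (by norm_num)] at hk
    linarith
  have hpos : ∀ k, 0 < poleWeight μ ζ k := by
    obtain ⟨m, hm⟩ := hev.exists
    have hμ0 : μ ≠ 0 := by
      rintro rfl
      simp [poleWeight] at hm
      linarith
    intro k
    have hR : 1 < 1 + (1 / 4 : ℝ) ^ k := by
      have : (0 : ℝ) < (1 / 4) ^ k := by positivity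
      linarith
    refine mul_pos (by positivity) ?_
    rw [integral_pos_iff_support_of_nonneg (fun l => by positivity) (integrable_inv_norm_sq hμ hζ hR)]
    have hsub : circleT ⊆ Function.support
        fun l => 1 / ‖((1 + (1 / 4) ^ k : ℝ) : ℂ) * ζ - l‖ ^ 2 := by
      intro l hl
      have hl1 : ‖l‖ = 1 := by simpa [circleT] using hl
      have h := sub_norm_le_norm_mul_sub hζ (R := 1 + (1 / 4) ^ k) (by linarith) l
      have : 0 < ‖((1 + (1 / 4) ^ k : ℝ) : ℂ) * ζ - l‖ := by linarith
      exact (one_div_pos.2 (pow_pos this 2)).ne'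
    refine lt_of_lt_of_le ?_ (measure_mono hsub)
    rw [pos_iff_ne_zero]
    intro h0
    refine hμ0 (Measure.measure_univ_eq_zero.1 ?_)
    rw [← union_compl_self circleT]
    exact measure_union_null h0 hμ
  refine ⟨hpos, ?_⟩
  refine Summable.of_norm_bounded_eventually_nat (hS.mul_left 2) ?_
  filter_upwards [hev] with k hk
  have h1 : (1 / 2 : ℝ) ^ k ≤ 1 := pow_le_one₀ (by norm_num) (by norm_num)
  rw [Real.norm_of_nonneg (one_div_pos.2 (hpos k)).le, mul_one_div,
    div_le_div_iff₀ (hpos k) (hb k)]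
  linarith

lemma lintegral_disc_affine (z : ℂ) {δ : ℝ} (hδ : 0 < δ) (h : ℂ → ℝ≥0∞) :
    ENNReal.ofReal (δ ^ 2) * ∫⁻ x in disc, h (z + δ * x) = ∫⁻ y in ball z δ, h y := by
  have hm : MeasurableEmbedding fun x : ℂ => z + δ • x :=
    ((Homeomorph.smulOfNeZero δ hδ.ne').trans (Homeomorph.addLeft z)).measurableEmbedding
  have h1 : Measure.map (fun x : ℂ => z + δ • x) volume =
      ENNReal.ofReal (|(δ ^ 2)⁻¹|) • (volume : Measure ℂ) := by
    have e1 : Measure.map (fun x : ℂ => δ • x) volume =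
        ENNReal.ofReal (|(δ ^ 2)⁻¹|) • (volume : Measure ℂ) := by
      simpa using Measure.map_addHaar_smul (volume : Measure ℂ) hδ.ne'
    have e2 := Measure.map_map (μ := (volume : Measure ℂ)) (measurable_const_add z)
      (measurable_const_smul (α := ℂ) δ)
    rw [e1, Measure.map_smul, map_add_left_eq_self] at e2
    exact e2.symm
  have hpre : (fun x : ℂ => z + δ • x) ⁻¹' ball z δ = disc := by
    ext x
    simp only [mem_preimage, mem_ball, dist_eq_norm, mem_disc, add_sub_cancel_left, norm_smul,
      Real.norm_of_nonneg hδ.le]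
    exact mul_lt_iff_lt_one_right hδ
  have h3 : ∫⁻ x in disc, h (z + δ * x) =
      ENNReal.ofReal (|(δ ^ 2)⁻¹|) * ∫⁻ y in ball z δ, h y := by
    rw [← hpre, ← smul_eq_mul, ← lintegral_smul_measure, ← Measure.restrict_smul, ← h1,
      hm.restrict_map, hm.lintegral_map]
    simp only [Complex.real_smul]
  rw [h3, ← mul_assoc, ← ENNReal.ofReal_mul (by positivity), abs_of_pos (by positivity),
    mul_inv_cancel₀ (by positivity), ENNReal.ofReal_one, one_mul]

lemma ofReal_norm_sq_le_lintegral_ball {G : ℂ → ℂ} (hGm : Measurable G) {z : ℂ} {δ : ℝ} (hδ : 0 < δ)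
    (hG : DifferentiableOn ℂ G (ball z δ)) :
    ENNReal.ofReal (Real.pi * δ ^ 2) * ENNReal.ofReal (‖G z‖ ^ 2) ≤
      ∫⁻ y in ball z δ, ENNReal.ofReal (‖G y‖ ^ 2) := by
  have hH : DifferentiableOn ℂ (fun x => G (z + δ * x)) disc := by
    refine hG.comp (by fun_prop) fun x hx => ?_
    rw [mem_disc] at hx
    rw [mem_ball, dist_eq_norm, add_sub_cancel_left, norm_mul, Complex.norm_real,
      Real.norm_of_nonneg hδ.le]
    nlinarith
  have hav : ∀ x ∈ disc, ENNReal.ofReal (‖G z‖ ^ 2) ≤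
      ∫⁻ t, ENNReal.ofReal (‖G (z + δ * (bpt t * x))‖ ^ 2) ∂cm := by
    intro x hx
    have h := ofReal_norm_sq_le_lintegral (diffContOnCl_dilate hH (mem_disc.1 hx)) (w := 0) (by simp)
    simp only [mul_zero, add_zero] at h
    refine h.trans_eq (lintegral_congr fun t => ?_)
    simp [pk, norm_bpt, mul_comm x]
  have hpi : volume disc = ENNReal.ofReal Real.pi := by
    rw [disc, Complex.volume_ball]
    simp [ENNReal.ofReal_eq_coe_nnreal Real.pi_pos.le, NNReal.pi]
    rfl
  rw [← lintegral_disc_affine z hδ, mul_comm Real.pi, ENNReal.ofReal_mul (by positivity), mul_assoc]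
  refine mul_le_mul' le_rfl ?_
  rw [← lintegral_disc_rotation_average (by fun_prop)]
  calc _ = ∫⁻ x in disc, ENNReal.ofReal (‖G z‖ ^ 2) := by
        rw [setLIntegral_const, hpi, mul_comm]
    _ ≤ _ := setLIntegral_mono' measurableSet_disc hav

lemma poleWeight_le_poissonLInt {μ : Measure ℂ} [IsFiniteMeasure μ] (hμ : OnCircle μ) {ζ : ℂ}
    (hζ : ‖ζ‖ = 1) (k : ℕ) {y : ℂ} (hy : (1 / 4) ^ k / 8 ≤ 1 - ‖y‖)
    (hyζ : ‖ζ - y‖ ≤ 2 * (1 / 4) ^ k) :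
    ENNReal.ofReal (poleWeight μ ζ k / 128) ≤ poissonLInt μ y := by
  have hs : (0:ℝ) < (1 / 4) ^ k := by positivity
  have h := ofReal_mul_lintegral_inv_norm_sq hμ hζ k (c := 1 / 128) (by norm_num)
  rw [div_eq_mul_one_div, mul_comm, ← h, poissonLInt, ← lintegral_const_mul' _ _ ENNReal.ofReal_ne_top]
  refine lintegral_mono_ae ?_
  filter_upwards [ae_norm_eq_one hμ] with l hl
  rw [← ENNReal.ofReal_mul (by positivity), bdryKernel_eq_pk hl, pk]
  refine ENNReal.ofReal_le_ofReal ?_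
  have hd := sub_norm_le_norm_mul_sub hζ (R := 1 + (1 / 4) ^ k) (by positivity) l
  set s : ℝ := (1 / 4) ^ k
  rw [hl] at hd
  have htri : ‖l - y‖ ≤ ‖((1 + s : ℝ) : ℂ) * ζ - l‖ + s + 2 * s := by
    have e : l - y = -(((1 + s : ℝ) : ℂ) * ζ - l) + s * ζ + (ζ - y) := by
      push_cast
      ring
    rw [e]
    refine (norm_add₃_le).trans ?_
    rw [norm_neg, norm_mul, hζ, mul_one, Complex.norm_real, Real.norm_of_nonneg hs.le]
    gcongr
  set d := ‖((1 + s : ℝ) : ℂ) * ζ - l‖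
  have hy1 : ‖y‖ < 1 := by linarith
  have hly : 0 < ‖l - y‖ := norm_pos_iff.2 (sub_ne_zero_of_norm hy1 hl)
  have hd0 : 0 < d := by linarith
  have h1 : s / 8 ≤ 1 - ‖y‖ ^ 2 := by nlinarith [norm_nonneg y]
  have h2 : ‖l - y‖ ≤ 4 * d := by linarith
  calc 1 / 128 * s * (1 / d ^ 2) = (s / 8) / (4 * d) ^ 2 := by field_simp; norm_num
    _ ≤ _ := by
      have h3 : 0 ≤ 1 - ‖y‖ ^ 2 := by linarith
      gcongr

/-- The measure with density `|deriv f|² P_μ` on the disc. -/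
def energyMeasure (μ : Measure ℂ) (f : ℂ → ℂ) : Measure ℂ :=
  (volume.restrict disc).withDensity fun z => ENNReal.ofReal (‖deriv f z‖ ^ 2) * poissonLInt μ z

/-- The points at distance less than `2 / 4 ^ k` from the circle. -/
def collar (k : ℕ) : Set ℂ := {y | 1 - ‖y‖ < 2 * (1 / 4) ^ k}

lemma measurableSet_collar (k : ℕ) : MeasurableSet (collar k) :=
  measurableSet_lt (by fun_prop) measurable_const

lemma collar_antitone : Antitone collar := fun k l hkl _ hy => by
  have h : (1 / 4 : ℝ) ^ l ≤ (1 / 4) ^ k := pow_le_pow_of_le_one (by norm_num) (by norm_num) hkl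
  exact lt_of_lt_of_le hy (mul_le_mul_of_nonneg_left h zero_le_two)

lemma isFiniteMeasure_energyMeasure {μ : Measure ℂ} [IsFiniteMeasure μ] (hμ : OnCircle μ) {f : ℂ → ℂ}
    (hf : MemD μ f) : IsFiniteMeasure (energyMeasure μ f) :=
  isFiniteMeasure_withDensity ((memD_iff hμ).1 hf).2

lemma energyMeasure_real_univ {μ : Measure ℂ} [IsFiniteMeasure μ] (hμ : OnCircle μ) (f : ℂ → ℂ) :
    (energyMeasure μ f).real univ = Real.pi * dirichletIntegral μ f := by
  rw [dirichletIntegral_eq hμ, ← mul_assoc, mul_one_div_cancel Real.pi_ne_zero, one_mul,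
    measureReal_def, energyMeasure, withDensity_apply _ MeasurableSet.univ, Measure.restrict_univ,
    dirichletLInt]

/-- The energy of `f` in the `k`-th dyadic ring. -/
def ringEnergy (μ : Measure ℂ) (f : ℂ → ℂ) (k : ℕ) : ℝ :=
  (energyMeasure μ f).real (collar k) - (energyMeasure μ f).real (collar (k + 2))

lemma ringEnergy_nonneg {μ : Measure ℂ} [IsFiniteMeasure μ] (hμ : OnCircle μ) {f : ℂ → ℂ}
    (hf : MemD μ f) (k : ℕ) : 0 ≤ ringEnergy μ f k := by
  have := isFiniteMeasure_energyMeasure hμ hf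
  exact sub_nonneg.2 (measureReal_mono (collar_antitone (by omega)))

lemma sum_ringEnergy_le {μ : Measure ℂ} [IsFiniteMeasure μ] (hμ : OnCircle μ) {f : ℂ → ℂ}
    (hf : MemD μ f) (N : ℕ) :
    ∑ k ∈ Finset.range N, ringEnergy μ f k ≤ 2 * (Real.pi * dirichletIntegral μ f) := by
  have := isFiniteMeasure_energyMeasure hμ hf
  have h : ∑ k ∈ Finset.range N, ringEnergy μ f k =
      (energyMeasure μ f).real (collar 0) + (energyMeasure μ f).real (collar 1) -
        (energyMeasure μ f).real (collar N) - (energyMeasure μ f).real (collar (N + 1)) := by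
    induction N with
    | zero => simp
    | succ N ih =>
      rw [Finset.sum_range_succ, ih, ringEnergy]
      ring
  rw [h, ← energyMeasure_real_univ hμ]
  have h0 := measureReal_mono (μ := energyMeasure μ f) (subset_univ (collar 0))
  have h1 := measureReal_mono (μ := energyMeasure μ f) (subset_univ (collar 1))
  have h2 := measureReal_nonneg (μ := energyMeasure μ f) (s := collar N)
  have h3 := measureReal_nonneg (μ := energyMeasure μ f) (s := collar (N + 1))
  linarith

lemma norm_deriv_sq_mul_poleWeight_le {μ : Measure ℂ} [IsFiniteMeasure μ] (hμ : OnCircle μ) {ζ : ℂ}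
    (hζ : ‖ζ‖ = 1) {f : ℂ → ℂ} (hf : MemD μ f) (k : ℕ) {ρ : ℝ}
    (h1 : 1 - (1 / 4) ^ k ≤ ρ) (h2 : ρ ≤ 1 - (1 / 4) ^ k / 4) :
    Real.pi * ((1 / 4) ^ k / 8) ^ 2 * ‖deriv f (ρ * ζ)‖ ^ 2 * (poleWeight μ ζ k / 128) ≤
      ringEnergy μ f k := by
  have := isFiniteMeasure_energyMeasure hμ hf
  have hs : (0:ℝ) < (1 / 4) ^ k := by positivity
  have hs1 : (1 / 4 : ℝ) ^ k ≤ 1 := pow_le_one₀ (by norm_num) (by norm_num)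
  have hρ : 0 ≤ ρ := by linarith
  set z : ℂ := ρ * ζ
  have hz : ‖z‖ = ρ := by simp [z, hζ, abs_of_nonneg hρ]
  have hzζ : ‖ζ - z‖ = 1 - ρ := by
    have e : ζ - z = ((1 - ρ : ℝ) : ℂ) * ζ := by
      simp only [z]
      push_cast
      ring
    rw [e, norm_mul, hζ, mul_one, Complex.norm_real, Real.norm_of_nonneg (by linarith)]
  have key : ∀ y ∈ ball z ((1 / 4) ^ k / 8), (1 / 4) ^ k / 8 ≤ 1 - ‖y‖ ∧
      1 - ‖y‖ < 2 * (1 / 4) ^ k ∧ ‖ζ - y‖ ≤ 2 * (1 / 4) ^ k := by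
    intro y hy
    rw [mem_ball, dist_eq_norm] at hy
    have i1 := norm_sub_norm_le y z
    have i2 := norm_sub_norm_le z y
    rw [norm_sub_rev] at i2
    have i3 := norm_sub_le_norm_sub_add_norm_sub ζ z y
    rw [norm_sub_rev z y, hzζ] at i3
    refine ⟨?_, ?_, ?_⟩ <;> linarith
  have hsub : ball z ((1 / 4) ^ k / 8) ⊆ disc := fun y hy => by
    rw [mem_disc]
    linarith [(key y hy).1]
  have hring : ball z ((1 / 4) ^ k / 8) ⊆ collar k \ collar (k + 2) := fun y hy => by
    refine ⟨(key y hy).2.1, fun h => ?_⟩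
    have h' : 1 - ‖y‖ < 2 * (1 / 4) ^ (k + 2) := h
    rw [pow_add] at h'
    linarith [(key y hy).1]
  have hdiff : DifferentiableOn ℂ (deriv f) (ball z ((1 / 4) ^ k / 8)) :=
    (hf.1.1.deriv isOpen_disc).mono hsub
  have hlow := ofReal_norm_sq_le_lintegral_ball (measurable_deriv f)
    (by positivity : (0:ℝ) < (1 / 4) ^ k / 8) hdiff
  have hE : ringEnergy μ f k = (energyMeasure μ f).real (collar k \ collar (k + 2)) := by
    rw [ringEnergy, measureReal_sdiff (collar_antitone (by omega)) (measurableSet_collar _)]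
  have hen : ENNReal.ofReal (poleWeight μ ζ k / 128) *
      ∫⁻ y in ball z ((1 / 4) ^ k / 8), ENNReal.ofReal (‖deriv f y‖ ^ 2) ≤
      energyMeasure μ f (collar k \ collar (k + 2)) := by
    rw [← lintegral_const_mul' _ _ ENNReal.ofReal_ne_top]
    refine le_trans ?_ (measure_mono hring)
    rw [energyMeasure, withDensity_apply _ measurableSet_ball,
      Measure.restrict_restrict measurableSet_ball, inter_eq_self_of_subset_left hsub]
    refine setLIntegral_mono' measurableSet_ball fun y hy => ?_
    rw [mul_comm]
    exact mul_le_mul' le_rfl (poleWeight_le_poissonLInt hμ hζ k (key y hy).1 (key y hy).2.2)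
  rw [hE, measureReal_def, ← ENNReal.ofReal_le_iff_le_toReal (measure_ne_top _ _), mul_comm,
    ENNReal.ofReal_mul (by have := poleWeight_nonneg μ ζ k; positivity),
    ENNReal.ofReal_mul (by positivity)]
  exact (mul_le_mul' le_rfl hlow).trans hen

lemma norm_sub_le_sqrt_ringEnergy {μ : Measure ℂ} [IsFiniteMeasure μ] (hμ : OnCircle μ) {ζ : ℂ}
    (hζ : ‖ζ‖ = 1) {f : ℂ → ℂ} (hf : MemD μ f) {k : ℕ} (hω : 0 < poleWeight μ ζ k) {r : ℝ}
    (h1 : 1 - (1 / 4) ^ k ≤ r) (h2 : r ≤ 1 - (1 / 4) ^ k / 4) :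
    ‖f (r * ζ) - f ((1 - (1 / 4) ^ k : ℝ) * ζ)‖ ≤
      √(8192 / Real.pi * ringEnergy μ f k * (1 / poleWeight μ ζ k)) := by
  have hs : (0:ℝ) < (1 / 4) ^ k := by positivity
  have hs1 : (1 / 4 : ℝ) ^ k ≤ 1 := pow_le_one₀ (by norm_num) (by norm_num)
  have hD := ringEnergy_nonneg hμ hf k
  set B := √(8192 / Real.pi * ringEnergy μ f k * (1 / poleWeight μ ζ k))
  have hderiv : ∀ x ∈ Icc (1 - (1 / 4) ^ k) r,
      HasDerivWithinAt (fun ρ : ℝ => f (ρ * ζ)) (deriv f (x * ζ) * ζ) (Icc (1 - (1 / 4) ^ k) r) x := by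
    intro x hx
    have hxd : (x * ζ : ℂ) ∈ disc := by
      rw [mem_disc, norm_mul, hζ, mul_one, Complex.norm_real, Real.norm_of_nonneg (by linarith [hx.1])]
      linarith [hx.2]
    have hg : HasDerivAt (fun w : ℂ => w * ζ) ζ (x : ℂ) := by
      simpa using (hasDerivAt_id (x : ℂ)).mul_const ζ
    exact ((differentiableAt_of_disc hf.1.1 hxd).hasDerivAt.comp (x : ℂ) hg).comp_ofReal.hasDerivWithinAt
  have hbound : ∀ x ∈ Ico (1 - (1 / 4) ^ k) r, ‖deriv f (x * ζ) * ζ‖ ≤ B / (1 / 4) ^ k := by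
    intro x hx
    rw [norm_mul, hζ, mul_one, le_div_iff₀ hs]
    refine Real.le_sqrt_of_sq_le ?_
    have h := norm_deriv_sq_mul_poleWeight_le hμ hζ hf k hx.1 (hx.2.le.trans h2)
    rw [mul_one_div, le_div_iff₀ hω, div_mul_eq_mul_div, le_div_iff₀ Real.pi_pos]
    linarith
  have h := norm_image_sub_le_of_norm_deriv_le_segment' hderiv hbound r ⟨h1, le_rfl⟩
  refine h.trans ?_
  rw [div_mul_eq_mul_div, div_le_iff₀ hs]
  exact mul_le_mul_of_nonneg_left (by linarith) (Real.sqrt_nonneg _)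

lemma norm_radial_sub_le {μ : Measure ℂ} [IsFiniteMeasure μ] (hμ : OnCircle μ) {ζ : ℂ}
    (hζ : ‖ζ‖ = 1) {f : ℂ → ℂ} (hf : MemD μ f) (hω : ∀ k, 0 < poleWeight μ ζ k) {r : ℝ}
    (h0 : 0 ≤ r) (h1 : r < 1) :
    ∃ N : ℕ, ‖f (r * ζ) - f 0‖ ≤ ∑ k ∈ Finset.range N,
      √(8192 / Real.pi * ringEnergy μ f k * (1 / poleWeight μ ζ k)) := by
  have hgrid : ∀ N : ℕ, ‖f ((1 - (1 / 4) ^ N : ℝ) * ζ) - f 0‖ ≤ ∑ k ∈ Finset.range N,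
      √(8192 / Real.pi * ringEnergy μ f k * (1 / poleWeight μ ζ k)) := by
    intro N
    induction N with
    | zero => simp
    | succ N ih =>
      have hs : (0:ℝ) < (1 / 4) ^ N := by positivity
      have h := norm_sub_le_sqrt_ringEnergy hμ hζ hf (hω N) (r := 1 - (1 / 4) ^ (N + 1))
        (by rw [pow_succ]; linarith) (by rw [pow_succ]; linarith)
      rw [Finset.sum_range_succ]
      exact (norm_sub_le_norm_sub_add_norm_sub _ _ _).trans ((add_le_add h ih).trans_eq (add_comm _ _))
  obtain ⟨N, hN1, hN2⟩ := exists_nat_pow_near_of_lt_one (sub_pos.2 h1)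
    (by linarith : 1 - r ≤ 1) (by norm_num : (0:ℝ) < 1 / 4) (by norm_num)
  rw [pow_succ] at hN1
  refine ⟨N + 1, ?_⟩
  have h := norm_sub_le_sqrt_ringEnergy hμ hζ hf (hω N) (r := r) (by linarith) (by linarith)
  rw [Finset.sum_range_succ]
  exact (norm_sub_le_norm_sub_add_norm_sub _ _ _).trans ((add_le_add h (hgrid N)).trans_eq (add_comm _ _))

/-- Evaluation along the radius ending at a point of positive capacity is bounded. -/
lemma exists_norm_sq_radial_le {μ : Measure ℂ} [IsFiniteMeasure μ] (hμ : OnCircle μ) {ζ : ℂ}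
    (hζ : ‖ζ‖ = 1) (hcap : 0 < cap μ {ζ}) :
    ∃ C : ℝ, 0 < C ∧ ∀ f, MemD μ f → ∀ r : ℝ, 0 ≤ r → r < 1 →
      ‖f (r * ζ)‖ ^ 2 ≤ C * dNormSq μ f := by
  obtain ⟨hω, hsum⟩ := exists_summable_inv_poleWeight hμ hζ hcap
  set S := ∑' k, 1 / poleWeight μ ζ k
  have hω0 : ∀ k, 0 ≤ 1 / poleWeight μ ζ k := fun k => (one_div_pos.2 (hω k)).le
  have hS : 0 ≤ S := tsum_nonneg hω0
  refine ⟨2 + 32768 * S, by positivity, fun f hf r h0 h1 => ?_⟩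
  obtain ⟨N, hN⟩ := norm_radial_sub_le hμ hζ hf hω h0 h1
  have hE := sum_ringEnergy_le hμ hf N
  have hE0 : 0 ≤ dirichletIntegral μ f := by
    rw [dirichletIntegral_eq hμ]
    positivity
  have hcs : (∑ k ∈ Finset.range N, √(8192 / Real.pi * ringEnergy μ f k * (1 / poleWeight μ ζ k))) ^ 2 ≤
      (∑ k ∈ Finset.range N, 8192 / Real.pi * ringEnergy μ f k) *
        ∑ k ∈ Finset.range N, 1 / poleWeight μ ζ k := by
    have hp : ∀ k, 0 ≤ 8192 / Real.pi * ringEnergy μ f k := fun k =>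
      mul_nonneg (by positivity) (ringEnergy_nonneg hμ hf k)
    exact Finset.sum_sq_le_sum_mul_sum_of_sq_le_mul _ (fun k _ => hp k) (fun k _ => hω0 k)
      fun k _ => (Real.sq_sqrt (mul_nonneg (hp k) (hω0 k))).le
  have hsq : ‖f (r * ζ) - f 0‖ ^ 2 ≤ 16384 * S * dirichletIntegral μ f := by
    refine (pow_le_pow_left₀ (norm_nonneg _) hN 2).trans (hcs.trans ?_)
    rw [← Finset.mul_sum]
    have e : 16384 * S * dirichletIntegral μ f =
        8192 / Real.pi * (2 * (Real.pi * dirichletIntegral μ f)) * S := by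
      field_simp
      ring
    rw [e]
    have hS' := hsum.sum_le_tsum (Finset.range N) fun k _ => hω0 k
    have hs0 : 0 ≤ ∑ k ∈ Finset.range N, 1 / poleWeight μ ζ k := Finset.sum_nonneg fun k _ => hω0 k
    have := Real.pi_pos
    gcongr
  have h00 := norm_sq_zero_le_hardyNormSq hf.1
  have htri : ‖f (r * ζ)‖ ^ 2 ≤ 2 * ‖f (r * ζ) - f 0‖ ^ 2 + 2 * ‖f 0‖ ^ 2 := by
    have h := norm_sub_norm_le (f (r * ζ)) (f 0)
    have h' : ‖f (r * ζ)‖ ≤ ‖f (r * ζ) - f 0‖ + ‖f 0‖ := by linarith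
    nlinarith [norm_nonneg (f (r * ζ)), sq_nonneg (‖f (r * ζ) - f 0‖ - ‖f 0‖)]
  have hH : 0 ≤ hardyNormSq f := (sq_nonneg _).trans h00
  have hSH := mul_nonneg hS hH
  rw [dNormSq]
  linarith

lemma memD_polynomial_mul_pow {μ : Measure ℂ} [IsFiniteMeasure μ] (hμ : OnCircle μ) (q : Polynomial ℂ)
    (ζ : ℂ) (n : ℕ) : MemD μ fun z => q.eval z * (z - ζ) ^ n := by
  set p : Polynomial ℂ := q * (Polynomial.X - Polynomial.C ζ) ^ n
  have e : (fun z => q.eval z * (z - ζ) ^ n) = fun z => p.eval z := by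
    ext z
    simp [p]
  have hb : ∀ P : Polynomial ℂ, ∃ A : ℝ, ∀ z ∈ disc, ‖P.eval z‖ ≤ A := by
    intro P
    obtain ⟨A, hA⟩ := (isCompact_closedBall (0 : ℂ) 1).exists_bound_of_continuousOn
      P.continuous.continuousOn
    exact ⟨A, fun z hz => hA z (ball_subset_closedBall hz)⟩
  obtain ⟨A, hA⟩ := hb p
  obtain ⟨C, hC⟩ := hb p.derivative
  rw [e]
  exact memD_of_deriv_bound hμ p.differentiable.differentiableOn hA
    fun z hz => by simpa using hC z hz

lemma hasRadialLimitAt_of_mem_closedSpan {μ : Measure ℂ} [IsFiniteMeasure μ] (hμ : OnCircle μ) {ζ : ℂ}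
    (hζ : ‖ζ‖ = 1) {n : ℕ} (hn : 1 ≤ n) (hcap : 0 < cap μ {ζ}) {g : ℂ → ℂ}
    (hg : g ∈ closedSpan μ fun z => (z - ζ) ^ n) : HasRadialLimitAt g ζ 0 := by
  obtain ⟨C, hC, hbound⟩ := exists_norm_sq_radial_le hμ hζ hcap
  rw [HasRadialLimitAt, Metric.tendsto_nhds]
  intro ε hε
  obtain ⟨q, hq⟩ := hg.2 ((ε / 2) ^ 2 / C) (by positivity)
  have hh := hg.1.sub hμ (memD_polynomial_mul_pow hμ q ζ n)
  have hlim : Tendsto (fun r : ℝ => q.eval (r * ζ) * ((r * ζ : ℂ) - ζ) ^ n) (𝓝[<] 1) (𝓝 0) := by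
    have hc : Continuous fun r : ℝ => q.eval (r * ζ) * ((r * ζ : ℂ) - ζ) ^ n := by
      have := q.continuous
      fun_prop
    have h := (hc.tendsto 1).mono_left (nhdsWithin_le_nhds (s := Iio 1))
    simpa [zero_pow (by omega : n ≠ 0)] using h
  have hpos : ∀ᶠ r : ℝ in 𝓝[<] 1, 0 ≤ r :=
    nhdsWithin_le_nhds (Ici_mem_nhds one_pos)
  filter_upwards [(Metric.tendsto_nhds.1 hlim) (ε / 2) (by positivity), hpos, self_mem_nhdsWithin]
    with r hr h0 h1
  rw [dist_zero_right] at hr ⊢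
  have h := hbound _ hh r h0 h1
  have h' : ‖g (r * ζ) - q.eval (r * ζ) * ((r * ζ : ℂ) - ζ) ^ n‖ ^ 2 < (ε / 2) ^ 2 :=
    h.trans_lt (by rwa [lt_div_iff₀' hC] at hq)
  have h2 := lt_of_pow_lt_pow_left₀ 2 (by positivity) h'
  have h3 := norm_sub_norm_le (g (r * ζ)) (q.eval (r * ζ) * ((r * ζ : ℂ) - ζ) ^ n)
  linarith

/-- If `c_μ({ζ}) > 0` then `[(z - ζ)ⁿ]_{D(μ)} = M_μ({ζ})
= {g ∈ D(μ) : radial limit of g at ζ exists and is 0}`. -/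
theorem closedSpan_pow_of_cap_pos
    (μ : Measure ℂ) [IsFiniteMeasure μ] (hμ : OnCircle μ)
    (ζ : ℂ) (hζ : ζ ∈ circleT) (n : ℕ) (hn : 1 ≤ n)
    (hcap : 0 < cap μ {ζ}) :
    closedSpan μ (fun z => (z - ζ) ^ n) =
      {g | MemD μ g ∧ HasRadialLimitAt g ζ 0} := by
  have hζ1 : ‖ζ‖ = 1 := mem_sphere_zero_iff_norm.1 hζ
  ext g
  exact ⟨fun hg => ⟨hg.1, hasRadialLimitAt_of_mem_closedSpan hμ hζ1 hn hcap hg⟩,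
    fun hg => mem_closedSpan_of_hasRadialLimitAt hμ hζ1 n hg.1 hg.2⟩

end DirichletMu
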